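/- arXiv:2306.04381 — 4 statements merged into one kernel-verified Lean document; each statement's English description precedes it below -/
import Mathlib

section
/- Let (V, ⊳, [·,·]) be a post-Lie algebra, g = (V, [·,·]) its underlying Lie algebra, and U(g) its universal enveloping algebra with concatenation product · and unshuffle coproduct Δ_sh (so that (U(g), ·, Δ_sh) is the usual enveloping Hopf algebra). Extend ⊳ to U(g) by the rules 1 ⊳ A = A, (xA) ⊳ y = x ⊳ (A ⊳ y) − (x ⊳ A) ⊳ y, and A ⊳ (BC) = (A_(1) ⊳ B)(A_(2) ⊳ C) for x, y ∈ g and A, B, C ∈ U(g), and define A ∗ B := A_(1) · (A_(2) ⊳ B). Then (U(g), ∗, Δ_sh) is a Hopf algebra, and it is isomorphic as a Hopf algebra to the enveloping Hopf algebra U(g̃) of the Lie algebra g̃ = (V, ⟦·,·⟧), where ⟦x,y⟧ := x ⊳ y − y ⊳ x + [x,y]. -/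
open TensorProduct

/-!
STATEMENT 1: Let (V, ⊳, [·,·]) be a post-Lie algebra, g = (V,[·,·]) its underlying Lie
algebra and U(g) its universal enveloping algebra with concatenation product · and
unshuffle coproduct Δ_sh.  Extend ⊳ to U(g) by
  1 ⊳ A = A,   (xA) ⊳ y = x ⊳ (A ⊳ y) − (x ⊳ A) ⊳ y,   A ⊳ (BC) = (A₍₁₎ ⊳ B)(A₍₂₎ ⊳ C),
and set A ∗ B := A₍₁₎ · (A₍₂₎ ⊳ B).  Then (U(g), ∗, Δ_sh) is a Hopf algebra, and it is
isomorphic as a Hopf algebra to the enveloping Hopf algebra U(g̃) of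
g̃ = (V, ⟦·,·⟧), ⟦x,y⟧ = x ⊳ y − y ⊳ x + [x,y].

The enveloping Hopf algebra structures (on U(g) and on U(g̃)) are encoded by their
characterizing properties: the coproduct is an algebra morphism making the image of
the Lie algebra primitive.
-/

section GuinOudom

variable {K : Type*} [Field K] [CharZero K]

/-- The Grossman–Larson-type product `A ∗ B = A₍₁₎ · (A₍₂₎ ⊳ B)` associated to a
coproduct `comul` and an extension `GR` of the post-Lie product, as a linear map
`U ⊗ U → U`. -/
noncomputable def starT (U : Type*) [Ring U] [Algebra K U]
    (comul : U →ₗ[K] U ⊗[K] U) (GR : U →ₗ[K] U →ₗ[K] U) :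
    U ⊗[K] U →ₗ[K] U :=
  (LinearMap.mul' K U) ∘ₗ
    (TensorProduct.map LinearMap.id (TensorProduct.lift GR)) ∘ₗ
    (TensorProduct.assoc K U U U).toLinearMap ∘ₗ
    (LinearMap.rTensor U comul)

/-- The induced product on `U ⊗ U`: `(A ⊗ B) ∗₂ (C ⊗ D) = (A ∗ C) ⊗ (B ∗ D)`. -/
noncomputable def starT2 (U : Type*) [Ring U] [Algebra K U]
    (comul : U →ₗ[K] U ⊗[K] U) (GR : U →ₗ[K] U →ₗ[K] U) :
    (U ⊗[K] U) ⊗[K] (U ⊗[K] U) →ₗ[K] U ⊗[K] U :=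
  (TensorProduct.map (starT (K := K) U comul GR) (starT (K := K) U comul GR)) ∘ₗ
    (TensorProduct.tensorTensorTensorComm K U U U U).toLinearMap

end GuinOudom

section LeftGeneration

variable {K : Type*} [CommRing K] {L : Type*} [AddCommGroup L] [Module K L]
  {U : Type*} [Ring U] [Algebra K U]

/-- The algebra `U` is spanned by the words in the image of `i`, in the form of an induction
principle on left multiplications. -/
def LeftGenerated (i : L →ₗ[K] U) : Prop :=
  ∀ S : Submodule K U, 1 ∈ S → (∀ x, ∀ A ∈ S, i x * A ∈ S) → S = ⊤

theorem LeftGenerated.induction {i : L →ₗ[K] U} (hi : LeftGenerated i) {p : U → Prop}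
    (h_one : p 1) (h_add : ∀ A B, p A → p B → p (A + B)) (h_smul : ∀ (c : K) A, p A → p (c • A))
    (h_mul : ∀ x A, p A → p (i x * A)) (A : U) : p A := by
  let S : Submodule K U :=
    { carrier := {A | p A}
      add_mem' := fun {A B} => h_add A B
      zero_mem' := by simpa using h_smul 0 1 h_one
      smul_mem' := h_smul }
  have h_top : S = ⊤ := hi S h_one h_mul
  exact h_top.ge (Submodule.mem_top (x := A))

theorem LeftGenerated.linearMap_ext {i : L →ₗ[K] U} (hi : LeftGenerated i)
    {M : Type*} [AddCommGroup M] [Module K M] {f g : U →ₗ[K] M} (h_one : f 1 = g 1)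
    (h_mul : ∀ x A, f A = g A → f (i x * A) = g (i x * A)) (A : U) : f A = g A := by
  have h := hi (LinearMap.eqLocus f g) h_one h_mul
  exact LinearMap.congr_fun (LinearMap.eqLocus_eq_top.mp h) A

variable {comul : U →ₗ[K] U ⊗[K] U} {i : L →ₗ[K] U}

/-- In a bialgebra generated by primitives, the coproduct of a word `A` of length at most `n` is
`A ⊗ 1` up to tensors whose left factor is a combination of shorter words. -/
theorem comul_sub_tmul_one_mem (hcomul_one : comul 1 = 1 ⊗ₜ[K] 1)
    (hcomul_mul : ∀ A B, comul (A * B) = comul A * comul B)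
    (hcomul_prim : ∀ x, comul (i x) = i x ⊗ₜ[K] 1 + 1 ⊗ₜ[K] i x) (n : ℕ) :
    ∀ A ∈ (1 ⊔ LinearMap.range i : Submodule K U) ^ n,
      comul A - A ⊗ₜ[K] 1 ∈ Submodule.span K {t : U ⊗[K] U |
        ∃ m < n, ∃ a ∈ (1 ⊔ LinearMap.range i : Submodule K U) ^ m, ∃ b, t = a ⊗ₜ[K] b} := by
  induction n with
  | zero =>
    intro A hA
    rw [pow_zero] at hA
    obtain ⟨c, rfl⟩ := Submodule.mem_one.mp hA
    simp [Algebra.algebraMap_eq_smul_one, hcomul_one, TensorProduct.smul_tmul']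
  | succ n ih =>
    intro A hA
    set W : Submodule K U := 1 ⊔ LinearMap.range i with hW
    have h_prim : ∀ x, i x ∈ W := fun x => Submodule.mem_sup_right ⟨x, rfl⟩
    rw [pow_succ'] at hA
    induction hA using Submodule.mul_induction_on' with
    | add A _ B _ hA hB =>
      rw [map_add, TensorProduct.add_tmul, add_sub_add_comm]
      exact add_mem hA hB
    | mem_mul_mem w hw A hA =>
      obtain ⟨u, hu, v, ⟨x, rfl⟩, rfl⟩ := Submodule.mem_sup.mp hw
      obtain ⟨c, rfl⟩ := Submodule.mem_one.mp hu
      have h_expand : comul ((algebraMap K U c + i x) * A) -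
            ((algebraMap K U c + i x) * A) ⊗ₜ[K] 1 =
          c • (comul A - A ⊗ₜ[K] 1) +
            (i x ⊗ₜ[K] 1 + 1 ⊗ₜ[K] i x) * (comul A - A ⊗ₜ[K] 1) + A ⊗ₜ[K] i x := by
        rw [Algebra.algebraMap_eq_smul_one, add_mul, map_add, hcomul_mul (i x), hcomul_prim,
          mul_sub, add_mul _ _ (A ⊗ₜ[K] (1 : U))]
        simp only [smul_mul_assoc, one_mul, mul_one, map_smul, TensorProduct.add_tmul,
          smul_sub, Algebra.TensorProduct.tmul_mul_tmul, TensorProduct.smul_tmul']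
        abel
      rw [h_expand]
      refine add_mem (add_mem (Submodule.smul_mem _ _ (Submodule.span_mono ?_ (ih A hA))) ?_)
        (Submodule.subset_span ⟨n, n.lt_succ_self, A, hA, _, rfl⟩)
      · rintro t ⟨m, hm, h⟩
        exact ⟨m, hm.trans n.lt_succ_self, h⟩
      · refine Submodule.span_induction
          (p := fun t _ => (i x ⊗ₜ[K] 1 + 1 ⊗ₜ[K] i x) * t ∈ Submodule.span K
            {t : U ⊗[K] U | ∃ m < n + 1, ∃ a ∈ W ^ m, ∃ b, t = a ⊗ₜ[K] b})
          ?_ ?_ ?_ ?_ (ih A hA)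
        · rintro _ ⟨m, hm, a, ha, b, rfl⟩
          simp only [add_mul, Algebra.TensorProduct.tmul_mul_tmul, one_mul]
          refine add_mem (Submodule.subset_span ⟨m + 1, by lia, i x * a, ?_, b, rfl⟩)
            (Submodule.subset_span ⟨m, by lia, a, ha, i x * b, rfl⟩)
          rw [pow_succ']
          exact Submodule.mul_mem_mul (h_prim x) ha
        · simp
        · intro s t _ _ hs ht
          rw [mul_add]
          exact add_mem hs ht
        · intro c t _ ht
          rw [mul_smul_comm]
          exact Submodule.smul_mem _ _ ht

/-- In a bialgebra generated by primitives, an endomorphism that is idempotent for convolution and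
vanishes at `1` is zero. -/
theorem LeftGenerated.eq_zero_of_convolution_idempotent (hi : LeftGenerated i)
    (hcomul_one : comul 1 = 1 ⊗ₜ[K] 1)
    (hcomul_mul : ∀ A B, comul (A * B) = comul A * comul B)
    (hcomul_prim : ∀ x, comul (i x) = i x ⊗ₜ[K] 1 + 1 ⊗ₜ[K] i x)
    (f : U →ₗ[K] U) (hf_one : f 1 = 0)
    (hf : ∀ A, LinearMap.mul' K U (TensorProduct.map f f (comul A)) = f A) (A : U) :
    f A = 0 := by
  set W : Submodule K U := 1 ⊔ LinearMap.range i with hW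
  have h_vanish : ∀ n, ∀ A ∈ W ^ n, f A = 0 := by
    intro n
    induction n using Nat.strong_induction_on with
    | _ n ih =>
      intro A hA
      have h_short : LinearMap.mul' K U (TensorProduct.map f f (comul A - A ⊗ₜ[K] 1)) = 0 := by
        refine Submodule.span_induction
          (p := fun t _ => LinearMap.mul' K U (TensorProduct.map f f t) = 0) ?_ (by simp) ?_ ?_
          (comul_sub_tmul_one_mem hcomul_one hcomul_mul hcomul_prim n A hA)
        · rintro _ ⟨m, hm, a, ha, b, rfl⟩
          simp [ih m hm a ha]
        · intro s t _ _ hs ht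
          rw [map_add, map_add, hs, ht, add_zero]
        · intro c t _ ht
          rw [map_smul, map_smul, ht, smul_zero]
      rw [map_sub, map_sub, hf, TensorProduct.map_tmul, hf_one] at h_short
      simpa using h_short
  have h_top : ⨆ n, W ^ n = ⊤ := by
    refine hi _ (Submodule.mem_iSup_of_mem 0 (by rw [pow_zero]; exact Submodule.one_le.mp le_rfl)) fun x => ?_
    have h_le : ⨆ n, W ^ n ≤ (⨆ n, W ^ n).comap (LinearMap.mulLeft K (i x)) := by
      refine iSup_le fun n A hA => Submodule.mem_iSup_of_mem (n + 1) ?_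
      rw [pow_succ']
      exact Submodule.mul_mem_mul (Submodule.mem_sup_right ⟨x, rfl⟩) hA
    exact fun A hA => h_le hA
  have h_ker : ⨆ n, W ^ n ≤ LinearMap.ker f := iSup_le fun n A hA => h_vanish n A hA
  exact h_ker (h_top ▸ Submodule.mem_top)

/-- In a bialgebra generated by primitives, the counit is the only unital endomorphism that is
idempotent for convolution. -/
theorem LeftGenerated.eq_counit_of_convolution_idempotent (hi : LeftGenerated i)
    {counit : U →ₗ[K] K} (hcomul_one : comul 1 = 1 ⊗ₜ[K] 1)
    (hcomul_mul : ∀ A B, comul (A * B) = comul A * comul B)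
    (hcomul_prim : ∀ x, comul (i x) = i x ⊗ₜ[K] 1 + 1 ⊗ₜ[K] i x)
    (hcounit_one : counit 1 = 1)
    (hcounit_l : ∀ A, TensorProduct.lid K U (LinearMap.rTensor _ counit (comul A)) = A)
    (hcounit_r : ∀ A, TensorProduct.rid K U (LinearMap.lTensor _ counit (comul A)) = A)
    (f : U →ₗ[K] U) (hf_one : f 1 = 1)
    (hf : ∀ A, LinearMap.mul' K U (TensorProduct.map f f (comul A)) = f A) (A : U) :
    f A = counit A • 1 := by
  have h_expand : ∀ t : U ⊗[K] U,
      LinearMap.mul' K U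
          (TensorProduct.map (counit.smulRight 1 - f) (counit.smulRight 1 - f) t) =
        counit (TensorProduct.lid K U (LinearMap.rTensor _ counit t)) • 1 -
          f (TensorProduct.lid K U (LinearMap.rTensor _ counit t)) -
          f (TensorProduct.rid K U (LinearMap.lTensor _ counit t)) +
          LinearMap.mul' K U (TensorProduct.map f f t) := by
    intro t
    induction t with
    | zero => simp
    | tmul a b => simp [sub_mul, mul_sub, smul_sub, mul_smul, smul_comm (counit b)]; abel
    | add s t hs ht =>
      simp only [map_add, hs, ht, add_smul]
      abel
  have h := hi.eq_zero_of_convolution_idempotent hcomul_one hcomul_mul hcomul_prim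
    (counit.smulRight 1 - f) (by simp [hcounit_one, hf_one])
    (fun B => by rw [h_expand, hcounit_l, hcounit_r, hf]; simp) A
  exact (sub_eq_zero.mp h).symm

end LeftGeneration

section EnvelopingAlgebra

attribute [local instance] LieRing.ofAssociativeRing

variable {K : Type*} [CommRing K] {L : Type*} [LieRing L] [LieAlgebra K L]

variable (K L) in
/-- The canonical map to the universal enveloping algebra, as a linear map. -/
noncomputable def envelopingι : L →ₗ[K] UniversalEnvelopingAlgebra K L :=
  (UniversalEnvelopingAlgebra.ι K : L →ₗ⁅K⁆ UniversalEnvelopingAlgebra K L)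

variable (K L) in
theorem leftGenerated_envelopingι : LeftGenerated (envelopingι K L) := by
  intro S h_one h_mul
  let stab : Subalgebra K (UniversalEnvelopingAlgebra K L) :=
    { carrier := {A | ∀ B ∈ S, A * B ∈ S}
      mul_mem' := fun {A B} hA hB C hC => by
        rw [mul_assoc]
        exact hA _ (hB _ hC)
      add_mem' := fun {A B} hA hB C hC => by
        rw [add_mul]
        exact add_mem (hA _ hC) (hB _ hC)
      algebraMap_mem' := fun c B hB => by
        rw [← Algebra.smul_def]
        exact S.smul_mem c hB }
  let toStab : L →ₗ⁅K⁆ stab :=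
    { toFun := fun x => ⟨UniversalEnvelopingAlgebra.ι K x, h_mul x⟩
      map_add' := fun x y => Subtype.ext (map_add _ x y)
      map_smul' := fun c x => Subtype.ext (map_smul _ c x)
      map_lie' := fun {x y} => Subtype.ext (LieHom.map_lie _ x y) }
  have h_id : stab.val.comp (UniversalEnvelopingAlgebra.lift K toStab) = AlgHom.id K _ := by
    ext x
    change ((UniversalEnvelopingAlgebra.lift K toStab (UniversalEnvelopingAlgebra.ι K x) : stab) :
      UniversalEnvelopingAlgebra K L) = UniversalEnvelopingAlgebra.ι K x
    rw [UniversalEnvelopingAlgebra.lift_ι_apply]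
    rfl
  refine eq_top_iff.mpr fun A _ => ?_
  have h_mem := (UniversalEnvelopingAlgebra.lift K toStab A).2 1 h_one
  have h_eq : ((UniversalEnvelopingAlgebra.lift K toStab A : stab) :
      UniversalEnvelopingAlgebra K L) = A := AlgHom.congr_fun h_id A
  rwa [mul_one, h_eq] at h_mem

theorem exists_linearMap_of_representation {M : Type*} [AddCommGroup M] [Module K M]
    (ρ : L →ₗ[K] M →ₗ[K] M)
    (hρ : ∀ x y m, ρ ⁅x, y⁆ m = ρ x (ρ y m) - ρ y (ρ x m)) (m₀ : M) :
    ∃ Φ : UniversalEnvelopingAlgebra K L →ₗ[K] M, Φ 1 = m₀ ∧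
      ∀ x A, Φ (envelopingι K L x * A) = ρ x (Φ A) := by
  let ρ' : L →ₗ⁅K⁆ Module.End K M :=
    { toLinearMap := ρ
      map_lie' := fun {x y} => LinearMap.ext (hρ x y) }
  refine ⟨(LinearMap.applyₗ m₀).comp (UniversalEnvelopingAlgebra.lift K ρ').toLinearMap, ?_, ?_⟩
  · simp
  · intro x A
    have h := UniversalEnvelopingAlgebra.lift_ι_apply K ρ' x
    change UniversalEnvelopingAlgebra.lift K ρ' (UniversalEnvelopingAlgebra.ι K x * A) m₀ =
      ρ x (UniversalEnvelopingAlgebra.lift K ρ' A m₀)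
    rw [map_mul, h]
    rfl

theorem envelopingι_mul_sub (x y : L) :
    envelopingι K L x * envelopingι K L y - envelopingι K L y * envelopingι K L x =
      envelopingι K L ⁅x, y⁆ :=
  ((UniversalEnvelopingAlgebra.ι K).map_lie x y).symm

theorem envelopingι_mul_mul_sub (x y : L) (A : UniversalEnvelopingAlgebra K L) :
    envelopingι K L x * (envelopingι K L y * A) - envelopingι K L y * (envelopingι K L x * A) =
      envelopingι K L ⁅x, y⁆ * A := by
  rw [← envelopingι_mul_sub, sub_mul, mul_assoc, mul_assoc]

end EnvelopingAlgebra

section PostLie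

variable {K : Type*} [CommRing K] {V : Type*} [LieRing V] [LieAlgebra K V]
  {V' : Type*} [LieRing V'] [LieAlgebra K V']

theorem postLie_lie_sub_sub (pl : V →ₗ[K] V →ₗ[K] V)
    (ax1 : ∀ x y z : V,
      pl ⁅x, y⁆ z = pl x (pl y z) - pl (pl x y) z - pl y (pl x z) + pl (pl y x) z)
    (ax2 : ∀ x y z : V, pl x ⁅y, z⁆ = ⁅pl x y, z⁆ + ⁅y, pl x z⁆) (x y z : V) :
    ⁅⁅x, y⁆ - pl y x, z⁆ - pl z (⁅x, y⁆ - pl y x) -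
        (⁅⁅x, z⁆ - pl z x, y⁆ - pl y (⁅x, z⁆ - pl z x)) =
      ⁅x, pl y z - pl z y + ⁅y, z⁆⁆ - pl (pl y z - pl z y + ⁅y, z⁆) x := by
  simp only [map_add, map_sub, LinearMap.add_apply, LinearMap.sub_apply, ax1, ax2, lie_add,
    lie_sub, sub_lie, leibniz_lie x y z]
  rw [← lie_skew y ⁅x, z⁆, ← lie_skew x (pl z y), ← lie_skew (pl y x) z, ← lie_skew (pl z x) y]
  abel

theorem postLie_lie_lie_sub (pl : V →ₗ[K] V →ₗ[K] V)
    (ax1 : ∀ x y z : V,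
      pl ⁅x, y⁆ z = pl x (pl y z) - pl (pl x y) z - pl y (pl x z) + pl (pl y x) z)
    (ax2 : ∀ x y z : V, pl x ⁅y, z⁆ = ⁅pl x y, z⁆ + ⁅y, pl x z⁆) (x y z : V) :
    (pl x (⁅y, z⁆ - pl z y) - pl (⁅y, z⁆ - pl z y) x + ⁅x, ⁅y, z⁆ - pl z y⁆) -
        (pl y (⁅x, z⁆ - pl z x) - pl (⁅x, z⁆ - pl z x) y + ⁅y, ⁅x, z⁆ - pl z x⁆) +
        (⁅x, pl y z⁆ - pl (pl y z) x) - (⁅y, pl x z⁆ - pl (pl x z) y) =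
      ⁅pl x y - pl y x + ⁅x, y⁆, z⁆ - pl z (pl x y - pl y x + ⁅x, y⁆) := by
  simp only [map_add, map_sub, LinearMap.sub_apply, ax1, ax2, lie_sub, sub_lie, add_lie,
    leibniz_lie x y z]
  rw [← lie_skew y (pl z x)]
  abel

/-- The action of the post-Lie algebra on the enveloping algebra of the subadjacent Lie algebra
that corresponds to the Guin–Oudom extension of the post-Lie product. -/
theorem exists_subadjacent_action (pl : V →ₗ[K] V →ₗ[K] V)
    (ax1 : ∀ x y z : V,
      pl ⁅x, y⁆ z = pl x (pl y z) - pl (pl x y) z - pl y (pl x z) + pl (pl y x) z)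
    (ax2 : ∀ x y z : V, pl x ⁅y, z⁆ = ⁅pl x y, z⁆ + ⁅y, pl x z⁆) (e : V ≃ₗ[K] V')
    (he : ∀ x y : V, ⁅e x, e y⁆ = e (pl x y - pl y x + ⁅x, y⁆)) :
    ∃ D : V →ₗ[K] UniversalEnvelopingAlgebra K V' →ₗ[K] UniversalEnvelopingAlgebra K V',
      (∀ x, D x 1 = 0) ∧
      ∀ x y B, D x (envelopingι K V' (e y) * B) =
        envelopingι K V' (e y) * D x B + envelopingι K V' (e (pl x y)) * B +
          D (⁅x, y⁆ - pl y x) B := by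
  let U := UniversalEnvelopingAlgebra K V'
  let j : V →ₗ[K] U := envelopingι K V' ∘ₗ e
  have h_j : ∀ x y A, j x * (j y * A) - j y * (j x * A) = j (pl x y - pl y x + ⁅x, y⁆) * A := by
    intro x y A
    have h := envelopingι_mul_mul_sub (K := K) (e x) (e y) A
    rwa [he] at h
  let ad : V →ₗ[K] V →ₗ[K] V := (LieAlgebra.ad K V : V →ₗ[K] Module.End K V)
  let act : V →ₗ[K] (U × (V →ₗ[K] U)) →ₗ[K] (U × (V →ₗ[K] U)) :=
    LinearMap.mk₂ K
      (fun y p => (j y * p.1, LinearMap.mulLeft K (j y) ∘ₗ p.2 +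
        LinearMap.mulRight K p.1 ∘ₗ j ∘ₗ pl.flip y + p.2 ∘ₗ (ad.flip y - pl y)))
      (fun y y' p => by
        ext <;> simp [add_mul]
        abel)
      (fun c y p => by ext <;> simp [smul_sub])
      (fun y p p' => by
        ext <;> simp [mul_add]
        abel)
      (fun c y p => by ext <;> simp [smul_sub])
  have h_fst : ∀ y p, (act y p).1 = j y * p.1 := fun _ _ => rfl
  have h_snd : ∀ y p x, (act y p).2 x =
      j y * p.2 x + j (pl x y) * p.1 + p.2 (⁅x, y⁆ - pl y x) := fun _ _ _ => rfl
  have h_act : ∀ y z p, act (pl y z - pl z y + ⁅y, z⁆) p =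
      act y (act z p) - act z (act y p) := by
    intro y z p
    refine Prod.ext (h_j y z p.1).symm (LinearMap.ext fun x => ?_)
    change _ = (act y (act z p)).2 x - (act z (act y p)).2 x
    have h_fst_coeff : pl x (pl y z - pl z y + ⁅y, z⁆) =
        (pl y (pl x z) - pl (pl x z) y + ⁅y, pl x z⁆) +
          (pl (pl x y) z - pl z (pl x y) + ⁅pl x y, z⁆) +
          (pl (⁅x, y⁆ - pl y x) z - pl (⁅x, z⁆ - pl z x) y) := by
      simp only [map_add, map_sub, LinearMap.sub_apply, ax1, ax2]
      abel
    simp only [h_snd, h_fst]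
    rw [h_fst_coeff, ← postLie_lie_sub_sub pl ax1 ax2, ← h_j y z]
    simp only [map_add j (_ + _), map_sub j (pl (_ - _) z),
      add_mul, sub_mul, ← h_j, map_sub p.2 (_ - _) (_ - _), mul_add]
    abel
  obtain ⟨Φ, h_one, h_mul⟩ := exists_linearMap_of_representation (act ∘ₗ e.symm.toLinearMap)
    (fun x y p => by
      obtain ⟨x, rfl⟩ := e.surjective x
      obtain ⟨y, rfl⟩ := e.surjective y
      simpa [he] using h_act x y p) ((1, 0) : U × (V →ₗ[K] U))
  have h_fst_id : ∀ B, (Φ B).1 = B :=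
    (leftGenerated_envelopingι K V').linearMap_ext
      (f := LinearMap.fst K _ _ ∘ₗ Φ) (g := LinearMap.id) (by simp [h_one]) fun x B hB => by
        have hB : (Φ B).1 = B := hB
        simp [h_mul, h_fst, hB, j]
  refine ⟨(LinearMap.snd K _ _ ∘ₗ Φ).flip, fun x => by simp [h_one], fun x y B => ?_⟩
  change (Φ _).2 x = _ * (Φ B).2 x + _ + (Φ B).2 _
  rw [h_mul, LinearMap.comp_apply, LinearEquiv.coe_coe, e.symm_apply_apply, h_snd, h_fst_id]
  rfl

theorem subadjacent_action_lie (pl : V →ₗ[K] V →ₗ[K] V)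
    (ax1 : ∀ x y z : V,
      pl ⁅x, y⁆ z = pl x (pl y z) - pl (pl x y) z - pl y (pl x z) + pl (pl y x) z)
    (ax2 : ∀ x y z : V, pl x ⁅y, z⁆ = ⁅pl x y, z⁆ + ⁅y, pl x z⁆)
    {U' : Type*} [Ring U'] [Algebra K U'] {j : V →ₗ[K] U'} (hj : LeftGenerated j)
    {D : V →ₗ[K] U' →ₗ[K] U'} (hD_one : ∀ x, D x 1 = 0)
    (hD_mul : ∀ x y B, D x (j y * B) =
      j y * D x B + j (pl x y) * B + D (⁅x, y⁆ - pl y x) B) (B : U') :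
    ∀ x y, D x (D y B) - D y (D x B) = D (pl x y - pl y x + ⁅x, y⁆) B := by
  induction B using hj.induction with
  | h_one => simp [hD_one]
  | h_add A B hA hB =>
    intro x y
    simp only [map_add (D _), ← hA, ← hB]
    abel
  | h_smul c A hA =>
    intro x y
    simp only [map_smul (D _), ← hA, smul_sub]
  | h_mul z B hB =>
    intro x y
    have h_coeff : pl (pl x y - pl y x + ⁅x, y⁆) z = pl x (pl y z) - pl y (pl x z) := by
      simp only [map_add, map_sub, LinearMap.add_apply, LinearMap.sub_apply, ax1]
      abel
    have h_split : ∀ a b c d, D (a - b + c - d) B = D a B - D b B + D c B - D d B :=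
      fun a b c d => by simp only [map_add, map_sub, LinearMap.add_apply, LinearMap.sub_apply]
    rw [hD_mul x, hD_mul y, hD_mul (_ + _), h_coeff, ← postLie_lie_lie_sub pl ax1 ax2, h_split]
    simp only [← hB, map_add (D _), hD_mul, map_sub j, mul_sub, sub_mul]
    abel

/-- `GR` is the Guin–Oudom extension of the product `pl` to a connected bialgebra `U` generated by
the primitive elements `i x`. -/
structure IsGuinOudomExtension {U : Type*} [Ring U] [Algebra K U] (i : V →ₗ[K] U)
    (pl : V →ₗ[K] V →ₗ[K] V) (comul : U →ₗ[K] U ⊗[K] U) (counit : U →ₗ[K] K)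
    (GR : U →ₗ[K] U →ₗ[K] U) : Prop where
  generated : LeftGenerated i
  lie_mul : ∀ x y A, i x * (i y * A) - i y * (i x * A) = i ⁅x, y⁆ * A
  comul_one : comul 1 = 1 ⊗ₜ[K] 1
  comul_mul : ∀ A B, comul (A * B) = comul A * comul B
  comul_prim : ∀ x, comul (i x) = i x ⊗ₜ[K] 1 + 1 ⊗ₜ[K] i x
  counit_one : counit 1 = 1
  counit_mul : ∀ A B, counit (A * B) = counit A * counit B
  counit_prim : ∀ x, counit (i x) = 0
  counit_l : ∀ A, TensorProduct.lid K U (LinearMap.rTensor _ counit (comul A)) = A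
  counit_r : ∀ A, TensorProduct.rid K U (LinearMap.lTensor _ counit (comul A)) = A
  post : ∀ x y, GR (i x) (i y) = i (pl x y)
  one_apply : ∀ A, GR 1 A = A
  mul_apply_prim : ∀ x A y, GR (i x * A) (i y) = GR (i x) (GR A (i y)) - GR (GR (i x) A) (i y)
  apply_mul : ∀ A B C, GR A (B * C) =
    LinearMap.mul' K U (TensorProduct.map (GR.flip B) (GR.flip C) (comul A))

/-- Left multiplication by the primitive element `i x` for the Grossman–Larson product. -/
def leftStar {U : Type*} [Ring U] [Algebra K U] (i : V →ₗ[K] U) (GR : U →ₗ[K] U →ₗ[K] U) :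
    V →ₗ[K] U →ₗ[K] U :=
  LinearMap.mul K U ∘ₗ i + GR ∘ₗ i

namespace IsGuinOudomExtension

variable {U : Type*} [Ring U] [Algebra K U] {i : V →ₗ[K] U} {pl : V →ₗ[K] V →ₗ[K] V}
  {comul : U →ₗ[K] U ⊗[K] U} {counit : U →ₗ[K] K} {GR : U →ₗ[K] U →ₗ[K] U}

theorem leftStar_apply (x : V) (A : U) : leftStar i GR x A = i x * A + GR (i x) A := rfl

variable (h : IsGuinOudomExtension i pl comul counit GR)
include h

theorem prim_apply_mul (x : V) (A B : U) :
    GR (i x) (A * B) = GR (i x) A * B + A * GR (i x) B := by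
  rw [h.apply_mul, h.comul_prim]
  simp [h.one_apply]

theorem prim_apply_one (x : V) : GR (i x) 1 = 0 := by
  simpa using h.prim_apply_mul x 1 1

theorem prim_apply_prim_mul (x y : V) (A : U) :
    GR (i x) (i y * A) = i (pl x y) * A + i y * GR (i x) A := by
  rw [h.prim_apply_mul, h.post]

theorem prim_apply_lie
    (ax1 : ∀ x y z : V,
      pl ⁅x, y⁆ z = pl x (pl y z) - pl (pl x y) z - pl y (pl x z) + pl (pl y x) z)
    (x y : V) (A : U) :
    GR (i (pl x y - pl y x + ⁅x, y⁆)) A = GR (i x) (GR (i y) A) - GR (i y) (GR (i x) A) := by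
  induction A using h.generated.induction with
  | h_one => simp [h.prim_apply_one]
  | h_add A B hA hB =>
    simp only [map_add (GR _), hA, hB]
    abel
  | h_smul c A hA => simp only [map_smul (GR _), hA, smul_sub]
  | h_mul z A hA =>
    have h_coeff : pl (pl x y - pl y x + ⁅x, y⁆) z = pl x (pl y z) - pl y (pl x z) := by
      simp only [map_add, map_sub, LinearMap.add_apply, LinearMap.sub_apply, ax1]
      abel
    rw [h.prim_apply_prim_mul, h_coeff, hA]
    simp only [map_add (GR _), h.prim_apply_prim_mul, map_sub i, mul_sub, sub_mul]
    abel

theorem prim_apply_leftStar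
    (ax1 : ∀ x y z : V,
      pl ⁅x, y⁆ z = pl x (pl y z) - pl (pl x y) z - pl y (pl x z) + pl (pl y x) z)
    (x y : V) (A : U) :
    GR (i x) (leftStar i GR y A) = leftStar i GR y (GR (i x) A) + leftStar i GR (pl x y) A +
      GR (i (⁅x, y⁆ - pl y x)) A := by
  have h_lie := h.prim_apply_lie ax1 x y A
  have h_coeff : pl x y - pl y x + ⁅x, y⁆ = pl x y + (⁅x, y⁆ - pl y x) := by abel
  rw [h_coeff, map_add i, map_add GR, LinearMap.add_apply] at h_lie
  simp only [leftStar_apply, map_add (GR _), h.prim_apply_prim_mul,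
    eq_add_of_sub_eq h_lie.symm]
  abel

theorem leftStar_lie
    (ax1 : ∀ x y z : V,
      pl ⁅x, y⁆ z = pl x (pl y z) - pl (pl x y) z - pl y (pl x z) + pl (pl y x) z)
    (x y : V) (A : U) :
    leftStar i GR (pl x y - pl y x + ⁅x, y⁆) A =
      leftStar i GR x (leftStar i GR y A) - leftStar i GR y (leftStar i GR x A) := by
  rw [leftStar_apply, h.prim_apply_lie ax1]
  simp only [leftStar_apply, map_add (GR _), h.prim_apply_prim_mul, map_add i, map_sub i, add_mul,
    sub_mul, mul_add, ← h.lie_mul]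
  abel

theorem counit_leftStar (x : V) (A : U) : counit (leftStar i GR x A) = 0 := by
  have h_prim : counit (GR (i x) A) = 0 := by
    refine h.generated.linearMap_ext (f := counit ∘ₗ GR (i x)) (g := 0) ?_ (fun y B hB => ?_) A
    · simp [h.prim_apply_one]
    · simp [h.prim_apply_prim_mul, h.counit_mul, h.counit_prim]
  rw [leftStar_apply, map_add, h.counit_mul, h.counit_prim, h_prim, zero_mul, add_zero]

theorem comul_prim_apply (x : V) (A : U) : comul (GR (i x) A) =
    LinearMap.rTensor U (GR (i x)) (comul A) + LinearMap.lTensor U (GR (i x)) (comul A) := by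
  have h_mul : ∀ s t : U ⊗[K] U,
      (LinearMap.rTensor U (GR (i x)) + LinearMap.lTensor U (GR (i x))) (s * t) =
        (LinearMap.rTensor U (GR (i x)) + LinearMap.lTensor U (GR (i x))) s * t +
          s * (LinearMap.rTensor U (GR (i x)) + LinearMap.lTensor U (GR (i x))) t := by
    intro s t
    induction s with
    | zero => simp
    | add s s' hs hs' =>
      simp only [add_mul, map_add, hs, hs']
      abel
    | tmul a b =>
      induction t with
      | zero => simp
      | add t t' ht ht' =>
        simp only [mul_add, map_add, ht, ht']
        abel
      | tmul a' b' =>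
        simp [h.prim_apply_mul, TensorProduct.add_tmul, TensorProduct.tmul_add, add_mul, mul_add]
        abel
  refine h.generated.linearMap_ext (f := comul ∘ₗ GR (i x))
    (g := (LinearMap.rTensor U (GR (i x)) + LinearMap.lTensor U (GR (i x))) ∘ₗ comul)
    ?_ (fun y B hB => ?_) A
  · simp [h.prim_apply_one, h.comul_one]
  · simp only [LinearMap.comp_apply] at hB ⊢
    rw [h.prim_apply_prim_mul, map_add, h.comul_mul, h.comul_mul, hB, h.comul_mul, h_mul]
    simp [h.comul_prim, h.post, h.prim_apply_one]

theorem comul_leftStar (x : V) (A : U) : comul (leftStar i GR x A) =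
    LinearMap.rTensor U (leftStar i GR x) (comul A) +
      LinearMap.lTensor U (leftStar i GR x) (comul A) := by
  have h_mul : ∀ t : U ⊗[K] U, (i x ⊗ₜ[K] 1 + 1 ⊗ₜ[K] i x) * t =
      LinearMap.rTensor U (LinearMap.mulLeft K (i x)) t +
        LinearMap.lTensor U (LinearMap.mulLeft K (i x)) t := by
    intro t
    induction t with
    | zero => simp
    | tmul a b => simp [add_mul]
    | add s t hs ht =>
      simp only [mul_add, map_add, hs, ht]
      abel
  have h_split : leftStar i GR x = LinearMap.mulLeft K (i x) + GR (i x) := rfl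
  rw [leftStar_apply, map_add, h.comul_mul, h.comul_prim_apply, h.comul_prim, h_mul, h_split,
    LinearMap.rTensor_add, LinearMap.lTensor_add, LinearMap.add_apply, LinearMap.add_apply]
  abel

theorem apply_one (A : U) : GR A 1 = counit A • 1 :=
  h.generated.eq_counit_of_convolution_idempotent h.comul_one h.comul_mul h.comul_prim
    h.counit_one h.counit_l h.counit_r (GR.flip 1) (h.one_apply 1)
    (fun B => by simpa using (h.apply_mul B 1 1).symm) A

theorem leftStar_apply_apply (x : V) (A B : U) :
    GR (leftStar i GR x A) B = GR (i x) (GR A B) := by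
  induction B using h.generated.induction generalizing A with
  | h_one =>
    rw [h.apply_one, h.apply_one, h.counit_leftStar, map_smul, h.prim_apply_one, smul_zero, zero_smul]
  | h_add B C hB hC => simp only [map_add, hB, hC]
  | h_smul c B hB => simp only [map_smul, hB]
  | h_mul y B hB =>
    have h_prim : ∀ A, GR (leftStar i GR x A) (i y) = GR (i x) (GR A (i y)) := by
      intro A
      rw [leftStar_apply, map_add, LinearMap.add_apply, h.mul_apply_prim, sub_add_cancel]
    have h_tensor : ∀ t : U ⊗[K] U,
        LinearMap.mul' K U (TensorProduct.map (GR.flip (i y)) (GR.flip B)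
          (LinearMap.rTensor U (leftStar i GR x) t + LinearMap.lTensor U (leftStar i GR x) t)) =
        GR (i x) (LinearMap.mul' K U (TensorProduct.map (GR.flip (i y)) (GR.flip B) t)) := by
      intro t
      induction t with
      | zero => simp
      | tmul a b => simp [h_prim, hB, h.prim_apply_mul]
      | add s t hs ht =>
        simp only [map_add] at hs ht ⊢
        rw [← hs, ← ht]
        abel
    rw [h.apply_mul, h.comul_leftStar, h_tensor, h.apply_mul]

end IsGuinOudomExtension

end PostLie

section GrossmanLarson

variable {K : Type*} [Field K] {V : Type*} [LieRing V] [LieAlgebra K V]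
  {U : Type*} [Ring U] [Algebra K U] {i : V →ₗ[K] U} {pl : V →ₗ[K] V →ₗ[K] V}
  {comul : U →ₗ[K] U ⊗[K] U} {counit : U →ₗ[K] K} {GR : U →ₗ[K] U →ₗ[K] U}

theorem starT_tmul (A B : U) : starT (K := K) U comul GR (A ⊗ₜ[K] B) =
    LinearMap.mul' K U (TensorProduct.map LinearMap.id (GR.flip B) (comul A)) := by
  have h : ∀ t : U ⊗[K] U, LinearMap.mul' K U
      (TensorProduct.map LinearMap.id (TensorProduct.lift GR)
        (TensorProduct.assoc K U U U (t ⊗ₜ[K] B))) =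
      LinearMap.mul' K U (TensorProduct.map LinearMap.id (GR.flip B) t) := by
    intro t
    induction t with
    | zero => simp
    | tmul a b => simp
    | add s t hs ht => simp only [TensorProduct.add_tmul, map_add, hs, ht]
  simpa [starT] using h (comul A)

namespace IsGuinOudomExtension

variable (h : IsGuinOudomExtension i pl comul counit GR)
include h

theorem starT_leftStar_tmul (x : V) (A B : U) :
    starT (K := K) U comul GR (leftStar i GR x A ⊗ₜ[K] B) =
      leftStar i GR x (starT (K := K) U comul GR (A ⊗ₜ[K] B)) := by
  have h_tensor : ∀ t : U ⊗[K] U,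
      LinearMap.mul' K U (TensorProduct.map LinearMap.id (GR.flip B)
        (LinearMap.rTensor U (leftStar i GR x) t + LinearMap.lTensor U (leftStar i GR x) t)) =
      leftStar i GR x
        (LinearMap.mul' K U (TensorProduct.map LinearMap.id (GR.flip B) t)) := by
    intro t
    induction t with
    | zero => simp
    | tmul a b =>
      simp [h.leftStar_apply_apply]
      simp only [leftStar_apply, h.prim_apply_mul, add_mul, mul_assoc]
      abel
    | add s t hs ht =>
      simp only [map_add] at hs ht ⊢
      rw [← hs, ← ht]
      abel
  rw [starT_tmul, h.comul_leftStar, h_tensor, starT_tmul]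

theorem one_starT (A : U) : starT (K := K) U comul GR ((1 : U) ⊗ₜ[K] A) = A := by
  simp [starT_tmul, h.comul_one, h.one_apply]

theorem starT_one (A : U) : starT (K := K) U comul GR (A ⊗ₜ[K] (1 : U)) = A := by
  have h_tensor : ∀ t : U ⊗[K] U,
      LinearMap.mul' K U (TensorProduct.map LinearMap.id (GR.flip 1) t) =
        TensorProduct.rid K U (LinearMap.lTensor _ counit t) := by
    intro t
    induction t with
    | zero => simp
    | tmul a b => simp [h.apply_one]
    | add s t hs ht => simp only [map_add, hs, ht]
  rw [starT_tmul, h_tensor, h.counit_r]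

end IsGuinOudomExtension

end GrossmanLarson

section SubadjacentEquiv

variable {K : Type*} [CommRing K] {V : Type*} [LieRing V] [LieAlgebra K V]
  {V' : Type*} [LieRing V'] [LieAlgebra K V']

theorem IsGuinOudomExtension.exists_subadjacent_equiv {pl : V →ₗ[K] V →ₗ[K] V}
    {comul : UniversalEnvelopingAlgebra K V →ₗ[K]
      UniversalEnvelopingAlgebra K V ⊗[K] UniversalEnvelopingAlgebra K V}
    {counit : UniversalEnvelopingAlgebra K V →ₗ[K] K}
    {GR : UniversalEnvelopingAlgebra K V →ₗ[K]
      UniversalEnvelopingAlgebra K V →ₗ[K] UniversalEnvelopingAlgebra K V}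
    (h : IsGuinOudomExtension (envelopingι K V) pl comul counit GR)
    (ax1 : ∀ x y z : V,
      pl ⁅x, y⁆ z = pl x (pl y z) - pl (pl x y) z - pl y (pl x z) + pl (pl y x) z)
    (ax2 : ∀ x y z : V, pl x ⁅y, z⁆ = ⁅pl x y, z⁆ + ⁅y, pl x z⁆) (e : V ≃ₗ[K] V')
    (he : ∀ x y : V, ⁅e x, e y⁆ = e (pl x y - pl y x + ⁅x, y⁆)) :
    ∃ Φ : UniversalEnvelopingAlgebra K V ≃ₗ[K] UniversalEnvelopingAlgebra K V', Φ 1 = 1 ∧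
      ∀ x A, Φ (leftStar (envelopingι K V) GR x A) = envelopingι K V' (e x) * Φ A := by
  obtain ⟨D, hD_one, hD_mul⟩ := exists_subadjacent_action pl ax1 ax2 e he
  have h_gen' : LeftGenerated (envelopingι K V' ∘ₗ e.toLinearMap) := fun S h_one h_mul =>
    leftGenerated_envelopingι K V' S h_one fun x A hA => by
      simpa using h_mul (e.symm x) A hA
  have hD_lie := fun x y B => subadjacent_action_lie pl ax1 ax2 h_gen' hD_one hD_mul B x y
  have h_lie' : ∀ x y A, envelopingι K V' (e x) * (envelopingι K V' (e y) * A) -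
      envelopingι K V' (e y) * (envelopingι K V' (e x) * A) =
      envelopingι K V' (e (pl x y - pl y x + ⁅x, y⁆)) * A := fun x y A => by
    rw [envelopingι_mul_mul_sub, he]
  obtain ⟨Ψ, hΨ_one, hΨ_mul⟩ := exists_linearMap_of_representation
    (leftStar (envelopingι K V) GR ∘ₗ e.symm.toLinearMap)
    (fun x y A => by
      obtain ⟨x, rfl⟩ := e.surjective x
      obtain ⟨y, rfl⟩ := e.surjective y
      simpa [he] using h.leftStar_lie ax1 x y A) (1 : UniversalEnvelopingAlgebra K V)
  replace hΨ_mul : ∀ x B, Ψ (envelopingι K V' (e x) * B) =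
      leftStar (envelopingι K V) GR x (Ψ B) := fun x B => by
    simpa using hΨ_mul (e x) B
  obtain ⟨Φ, hΦ_one, hΦ_mul⟩ := exists_linearMap_of_representation
    (LinearMap.mul K (UniversalEnvelopingAlgebra K V') ∘ₗ envelopingι K V' ∘ₗ e.toLinearMap - D)
    (fun x y B => by
      simp only [LinearMap.sub_apply, LinearMap.comp_apply, LinearMap.mul_apply',
        LinearEquiv.coe_coe, map_sub (D _), hD_mul, mul_sub]
      rw [eq_add_of_sub_eq (h_lie' x y B), eq_add_of_sub_eq (hD_lie x y B), ← lie_skew y x]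
      simp only [map_add e, map_sub e, map_add (envelopingι K V'), map_sub (envelopingι K V'),
        map_add D, map_sub D, map_neg D, add_mul, sub_mul, LinearMap.add_apply,
        LinearMap.sub_apply, LinearMap.neg_apply]
      abel) (1 : UniversalEnvelopingAlgebra K V')
  replace hΦ_mul : ∀ x A, Φ (envelopingι K V x * A) =
      envelopingι K V' (e x) * Φ A - D x (Φ A) := hΦ_mul
  have hΨ_D : ∀ B x, Ψ (D x B) = GR (envelopingι K V x) (Ψ B) := by
    intro B
    induction B using h_gen'.induction with
    | h_one => simp [hD_one, hΨ_one, h.prim_apply_one]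
    | h_add A B hA hB => simp [hA, hB]
    | h_smul c A hA => simp [hA]
    | h_mul y B hB =>
      intro x
      simp only [LinearMap.comp_apply, LinearEquiv.coe_coe]
      rw [hD_mul, map_add, map_add, hΨ_mul, hΨ_mul, hΨ_mul, hB, hB, h.prim_apply_leftStar ax1]
  have hΦ_prim : ∀ A x, Φ (GR (envelopingι K V x) A) = D x (Φ A) := by
    intro A
    induction A using h.generated.induction with
    | h_one => simp [hD_one, hΦ_one, h.prim_apply_one]
    | h_add A B hA hB => simp [hA, hB]
    | h_smul c A hA => simp [hA]
    | h_mul y A hA =>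
      intro x
      have h_D := hD_lie x y (Φ A)
      have h_coeff : pl x y - pl y x + ⁅x, y⁆ = pl x y + (⁅x, y⁆ - pl y x) := by abel
      rw [h_coeff, map_add D, LinearMap.add_apply] at h_D
      rw [h.prim_apply_prim_mul, map_add, hΦ_mul, hΦ_mul, hA, hΦ_mul, map_sub, hD_mul,
        eq_add_of_sub_eq h_D]
      abel
  have hΦ_leftStar : ∀ x A, Φ (leftStar (envelopingι K V) GR x A) =
      envelopingι K V' (e x) * Φ A := fun x A => by
    rw [leftStar_apply, map_add, hΦ_mul, hΦ_prim, sub_add_cancel]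
  have hΦΨ : Φ ∘ₗ Ψ = LinearMap.id := LinearMap.ext <|
    h_gen'.linearMap_ext (by simp [hΨ_one, hΦ_one]) fun x B hB => by
      simp only [LinearMap.comp_apply, LinearEquiv.coe_coe, LinearMap.id_apply] at hB ⊢
      rw [hΨ_mul, hΦ_leftStar, hB]
  have hΨΦ : Ψ ∘ₗ Φ = LinearMap.id := LinearMap.ext <|
    h.generated.linearMap_ext (by simp [hΨ_one, hΦ_one]) fun x A hA => by
      simp only [LinearMap.comp_apply, LinearMap.id_apply] at hA ⊢
      rw [hΦ_mul, map_sub, hΨ_mul, hΨ_D, hA, leftStar_apply, add_sub_cancel_right]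
  exact ⟨LinearEquiv.ofLinearMap Φ Ψ hΦΨ hΨΦ, hΦ_one, hΦ_leftStar⟩

theorem exists_enveloping_antipode
    {comul : UniversalEnvelopingAlgebra K V →ₗ[K]
      UniversalEnvelopingAlgebra K V ⊗[K] UniversalEnvelopingAlgebra K V}
    {counit : UniversalEnvelopingAlgebra K V →ₗ[K] K}
    (comul_one : comul 1 = 1 ⊗ₜ[K] 1) (comul_mul : ∀ A B, comul (A * B) = comul A * comul B)
    (comul_prim : ∀ x, comul (envelopingι K V x) =
      envelopingι K V x ⊗ₜ[K] 1 + 1 ⊗ₜ[K] envelopingι K V x)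
    (counit_one : counit 1 = 1) (counit_mul : ∀ A B, counit (A * B) = counit A * counit B)
    (counit_prim : ∀ x, counit (envelopingι K V x) = 0) :
    ∃ S : UniversalEnvelopingAlgebra K V →ₗ[K] UniversalEnvelopingAlgebra K V, ∀ A,
      LinearMap.mul' K _ (LinearMap.rTensor _ S (comul A)) = counit A • 1 ∧
      LinearMap.mul' K _ (LinearMap.lTensor _ S (comul A)) = counit A • 1 := by
  obtain ⟨S, hS_one, hS_mul⟩ := exists_linearMap_of_representation
    (-((LinearMap.mul K (UniversalEnvelopingAlgebra K V)).flip ∘ₗ envelopingι K V))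
    (fun x y A => by
      simp [← envelopingι_mul_sub, mul_assoc]) (1 : UniversalEnvelopingAlgebra K V)
  replace hS_mul : ∀ x A, S (envelopingι K V x * A) = -(S A * envelopingι K V x) := hS_mul
  have h_left : ∀ x (t : UniversalEnvelopingAlgebra K V ⊗[K] UniversalEnvelopingAlgebra K V),
      LinearMap.mul' K _ (LinearMap.rTensor _ S
        ((envelopingι K V x ⊗ₜ[K] 1 + 1 ⊗ₜ[K] envelopingι K V x) * t)) = 0 := by
    intro x t
    induction t with
    | zero => simp
    | tmul a b => simp [add_mul, hS_mul, mul_assoc]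
    | add s t hs ht => rw [mul_add, map_add, map_add, hs, ht, add_zero]
  have h_right : ∀ x (t : UniversalEnvelopingAlgebra K V ⊗[K] UniversalEnvelopingAlgebra K V),
      LinearMap.mul' K _ (LinearMap.lTensor _ S
        ((envelopingι K V x ⊗ₜ[K] 1 + 1 ⊗ₜ[K] envelopingι K V x) * t)) =
      envelopingι K V x * LinearMap.mul' K _ (LinearMap.lTensor _ S t) -
        LinearMap.mul' K _ (LinearMap.lTensor _ S t) * envelopingι K V x := by
    intro x t
    induction t with
    | zero => simp
    | tmul a b => simp [add_mul, hS_mul, mul_assoc, sub_eq_add_neg]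
    | add s t hs ht =>
      rw [mul_add, map_add, map_add, hs, ht, map_add, map_add, mul_add, add_mul]
      abel
  refine ⟨S, fun A => ⟨?_, ?_⟩⟩
  · refine (leftGenerated_envelopingι K V).linearMap_ext
      (f := LinearMap.mul' K _ ∘ₗ LinearMap.rTensor _ S ∘ₗ comul) (g := counit.smulRight 1)
      (by simp [comul_one, counit_one, hS_one]) (fun x B _ => ?_) A
    simp [comul_mul, comul_prim, counit_mul, counit_prim, h_left]
  · refine (leftGenerated_envelopingι K V).linearMap_ext
      (f := LinearMap.mul' K _ ∘ₗ LinearMap.lTensor _ S ∘ₗ comul) (g := counit.smulRight 1)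
      (by simp [comul_one, counit_one, hS_one]) (fun x B hB => ?_) A
    simp only [LinearMap.comp_apply, LinearMap.smulRight_apply] at hB ⊢
    rw [comul_mul, comul_prim, h_right, hB, counit_mul, counit_prim]
    simp

end SubadjacentEquiv

theorem guin_oudom_hopf_algebra {K : Type*} [Field K] [CharZero K]
    -- the post-Lie algebra (V, ⊳, [·,·]); g = (V, [·,·])
    {V : Type*} [LieRing V] [LieAlgebra K V]
    (pl : V →ₗ[K] V →ₗ[K] V)
    (ax1 : ∀ x y z : V,
      pl ⁅x, y⁆ z = pl x (pl y z) - pl (pl x y) z - pl y (pl x z) + pl (pl y x) z)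
    (ax2 : ∀ x y z : V, pl x ⁅y, z⁆ = ⁅pl x y, z⁆ + ⁅y, pl x z⁆)
    -- the unshuffle coproduct and counit on U(g), characterized by: they are algebra
    -- morphisms and the image of g is primitive
    (comul : UniversalEnvelopingAlgebra K V →ₗ[K]
      UniversalEnvelopingAlgebra K V ⊗[K] UniversalEnvelopingAlgebra K V)
    (counit : UniversalEnvelopingAlgebra K V →ₗ[K] K)
    (hcomul_one : comul 1 = 1 ⊗ₜ[K] 1)
    (hcomul_mul : ∀ A B : UniversalEnvelopingAlgebra K V,
      comul (A * B) = comul A * comul B)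
    (hcomul_prim : ∀ x : V,
      comul (UniversalEnvelopingAlgebra.ι K x) =
        UniversalEnvelopingAlgebra.ι K x ⊗ₜ[K] 1 + 1 ⊗ₜ[K] UniversalEnvelopingAlgebra.ι K x)
    (hcounit_one : counit 1 = 1)
    (hcounit_mul : ∀ A B, counit (A * B) = counit A * counit B)
    (hcounit_prim : ∀ x : V, counit (UniversalEnvelopingAlgebra.ι K x) = 0)
    (hcounit_l : ∀ A, (TensorProduct.lid K (UniversalEnvelopingAlgebra K V))
      ((LinearMap.rTensor _ counit) (comul A)) = A)
    (hcounit_r : ∀ A, (TensorProduct.rid K (UniversalEnvelopingAlgebra K V))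
      ((LinearMap.lTensor _ counit) (comul A)) = A)
    (hcoassoc : ∀ A, (TensorProduct.assoc K _ _ _)
        ((LinearMap.rTensor _ comul) (comul A)) =
      (LinearMap.lTensor _ comul) (comul A))
    -- the Guin–Oudom extension GR of ⊳ to U(g)
    (GR : UniversalEnvelopingAlgebra K V →ₗ[K]
      UniversalEnvelopingAlgebra K V →ₗ[K] UniversalEnvelopingAlgebra K V)
    (hGR_post : ∀ x y : V,
      GR (UniversalEnvelopingAlgebra.ι K x) (UniversalEnvelopingAlgebra.ι K y) =
        UniversalEnvelopingAlgebra.ι K (pl x y))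
    (hGR_one : ∀ A, GR 1 A = A)
    (hGR_left : ∀ (x : V) (A : UniversalEnvelopingAlgebra K V) (y : V),
      GR (UniversalEnvelopingAlgebra.ι K x * A) (UniversalEnvelopingAlgebra.ι K y) =
        GR (UniversalEnvelopingAlgebra.ι K x) (GR A (UniversalEnvelopingAlgebra.ι K y)) -
          GR (GR (UniversalEnvelopingAlgebra.ι K x) A) (UniversalEnvelopingAlgebra.ι K y))
    (hGR_right : ∀ A B C : UniversalEnvelopingAlgebra K V,
      GR A (B * C) =
        (LinearMap.mul' K (UniversalEnvelopingAlgebra K V))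
          ((TensorProduct.map (GR.flip B) (GR.flip C)) (comul A)))
    -- the Lie algebra g̃ = (V, ⟦·,·⟧)
    {V' : Type*} [LieRing V'] [LieAlgebra K V'] (e : V ≃ₗ[K] V')
    (he : ∀ x y : V, ⁅e x, e y⁆ = e (pl x y - pl y x + ⁅x, y⁆))
    -- the unshuffle coproduct and counit on U(g̃)
    (comul' : UniversalEnvelopingAlgebra K V' →ₗ[K]
      UniversalEnvelopingAlgebra K V' ⊗[K] UniversalEnvelopingAlgebra K V')
    (counit' : UniversalEnvelopingAlgebra K V' →ₗ[K] K)
    (hcomul'_one : comul' 1 = 1 ⊗ₜ[K] 1)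
    (hcomul'_mul : ∀ A B : UniversalEnvelopingAlgebra K V',
      comul' (A * B) = comul' A * comul' B)
    (hcomul'_prim : ∀ x : V',
      comul' (UniversalEnvelopingAlgebra.ι K x) =
        UniversalEnvelopingAlgebra.ι K x ⊗ₜ[K] 1 +
          1 ⊗ₜ[K] UniversalEnvelopingAlgebra.ι K x)
    (hcounit'_one : counit' 1 = 1)
    (hcounit'_mul : ∀ A B, counit' (A * B) = counit' A * counit' B)
    (hcounit'_prim : ∀ x : V', counit' (UniversalEnvelopingAlgebra.ι K x) = 0) :
    -- write ∗ for the Guin–Oudom product A ∗ B = A₍₁₎ · (A₍₂₎ ⊳ B)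
    -- (U(g), ∗, Δ_sh) is a Hopf algebra:
    (∀ A B C : UniversalEnvelopingAlgebra K V,
      starT (K := K) _ comul GR
          (starT (K := K) _ comul GR (A ⊗ₜ[K] B) ⊗ₜ[K] C) =
        starT (K := K) _ comul GR
          (A ⊗ₜ[K] starT (K := K) _ comul GR (B ⊗ₜ[K] C))) ∧
    (∀ A : UniversalEnvelopingAlgebra K V,
      starT (K := K) _ comul GR ((1 : UniversalEnvelopingAlgebra K V) ⊗ₜ[K] A) = A ∧
      starT (K := K) _ comul GR (A ⊗ₜ[K] (1 : UniversalEnvelopingAlgebra K V)) = A) ∧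
    -- Δ_sh is an algebra morphism for ∗
    (∀ A B : UniversalEnvelopingAlgebra K V,
      comul (starT (K := K) _ comul GR (A ⊗ₜ[K] B)) =
        starT2 (K := K) _ comul GR (comul A ⊗ₜ[K] comul B)) ∧
    (∀ A B : UniversalEnvelopingAlgebra K V,
      counit (starT (K := K) _ comul GR (A ⊗ₜ[K] B)) = counit A * counit B) ∧
    -- existence of an antipode for ∗
    (∃ S : UniversalEnvelopingAlgebra K V →ₗ[K] UniversalEnvelopingAlgebra K V,
      ∀ A : UniversalEnvelopingAlgebra K V,
        starT (K := K) _ comul GR ((LinearMap.rTensor _ S) (comul A)) = counit A • 1 ∧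
        starT (K := K) _ comul GR ((LinearMap.lTensor _ S) (comul A)) = counit A • 1) ∧
    -- and (U(g), ∗, Δ_sh) is isomorphic, as a Hopf algebra, to U(g̃)
    (∃ Φ : UniversalEnvelopingAlgebra K V ≃ₗ[K] UniversalEnvelopingAlgebra K V',
      Φ 1 = 1 ∧
      (∀ A B : UniversalEnvelopingAlgebra K V,
        Φ (starT (K := K) _ comul GR (A ⊗ₜ[K] B)) = Φ A * Φ B) ∧
      (∀ A : UniversalEnvelopingAlgebra K V,
        comul' (Φ A) = (TensorProduct.map Φ.toLinearMap Φ.toLinearMap) (comul A)) ∧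
      (∀ A : UniversalEnvelopingAlgebra K V, counit' (Φ A) = counit A)) := by
  have h : IsGuinOudomExtension (envelopingι K V) pl comul counit GR :=
    { generated := leftGenerated_envelopingι K V
      lie_mul := envelopingι_mul_mul_sub
      comul_one := hcomul_one
      comul_mul := hcomul_mul
      comul_prim := hcomul_prim
      counit_one := hcounit_one
      counit_mul := hcounit_mul
      counit_prim := hcounit_prim
      counit_l := hcounit_l
      counit_r := hcounit_r
      post := hGR_post
      one_apply := hGR_one
      mul_apply_prim := hGR_left
      apply_mul := hGR_right }
  obtain ⟨Φ, hΦ_one, hΦ_leftStar⟩ := h.exists_subadjacent_equiv ax1 ax2 e he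
  obtain ⟨S', hS'⟩ := exists_enveloping_antipode hcomul'_one hcomul'_mul hcomul'_prim
    hcounit'_one hcounit'_mul hcounit'_prim
  have h_gen' := leftGenerated_envelopingι K V'
  have h_symm_one : Φ.symm 1 = 1 := Φ.symm_apply_eq.mpr hΦ_one.symm
  have h_symm_mul : ∀ x P, Φ.symm (envelopingι K V' x * P) =
      leftStar (envelopingι K V) GR (e.symm x) (Φ.symm P) := fun x P => by
    rw [Φ.symm_apply_eq, hΦ_leftStar, e.apply_symm_apply, Φ.apply_symm_apply]
  have hΦ_mul : ∀ A B, Φ (starT (K := K) _ comul GR (A ⊗ₜ[K] B)) = Φ A * Φ B := by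
    intro A B
    obtain ⟨P, rfl⟩ := Φ.symm.surjective A
    rw [Φ.apply_symm_apply]
    induction P using h_gen'.induction with
    | h_one => rw [h_symm_one, h.one_starT, one_mul]
    | h_add P Q hP hQ => rw [map_add, TensorProduct.add_tmul, map_add, map_add, hP, hQ, add_mul]
    | h_smul c P hP =>
      rw [map_smul, ← TensorProduct.smul_tmul', map_smul, map_smul, hP, smul_mul_assoc]
    | h_mul x P hP =>
      rw [h_symm_mul, h.starT_leftStar_tmul, hΦ_leftStar, hP, e.apply_symm_apply, mul_assoc]
  have hΦ_comul : ∀ A, comul' (Φ A) =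
      TensorProduct.map Φ.toLinearMap Φ.toLinearMap (comul A) := by
    intro A
    obtain ⟨P, rfl⟩ := Φ.symm.surjective A
    rw [Φ.apply_symm_apply]
    have h_tensor : ∀ x (t : UniversalEnvelopingAlgebra K V ⊗[K] UniversalEnvelopingAlgebra K V),
        TensorProduct.map Φ.toLinearMap Φ.toLinearMap
          (LinearMap.rTensor _ (leftStar (envelopingι K V) GR x) t +
            LinearMap.lTensor _ (leftStar (envelopingι K V) GR x) t) =
          (envelopingι K V' (e x) ⊗ₜ[K] 1 + 1 ⊗ₜ[K] envelopingι K V' (e x)) *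
            TensorProduct.map Φ.toLinearMap Φ.toLinearMap t := by
      intro x t
      induction t with
      | zero => simp
      | tmul a b => simp [hΦ_leftStar, add_mul]
      | add s t hs ht =>
        simp only [map_add, mul_add] at hs ht ⊢
        rw [← hs, ← ht]
        abel
    induction P using h_gen'.induction with
    | h_one => simp [h_symm_one, hcomul'_one, hcomul_one, hΦ_one]
    | h_add P Q hP hQ => simp only [map_add, hP, hQ]
    | h_smul c P hP => simp only [map_smul, hP]
    | h_mul x P hP =>
      rw [h_symm_mul, h.comul_leftStar, h_tensor, ← hP, hcomul'_mul, e.apply_symm_apply]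
      exact congrArg (· * _) (hcomul'_prim x)
  have hΦ_counit : ∀ A, counit' (Φ A) = counit A := by
    intro A
    obtain ⟨P, rfl⟩ := Φ.symm.surjective A
    rw [Φ.apply_symm_apply]
    refine h_gen'.linearMap_ext (f := counit') (g := counit ∘ₗ Φ.symm.toLinearMap) ?_
      (fun x Q _ => ?_) P
    · simp [h_symm_one, hcounit'_one, hcounit_one]
    · rw [hcounit'_mul, LinearMap.comp_apply, LinearEquiv.coe_coe, h_symm_mul, h.counit_leftStar]
      exact mul_eq_zero_of_left (hcounit'_prim x) _
  have h_mul' : ∀ t, Φ (starT (K := K) _ comul GR t) =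
      LinearMap.mul' K _ (TensorProduct.map Φ.toLinearMap Φ.toLinearMap t) := by
    intro t
    induction t with
    | zero => simp
    | tmul a b => simpa using hΦ_mul a b
    | add s t hs ht => simp only [map_add, hs, ht]
  refine ⟨fun A B C => Φ.injective ?_, fun A => ⟨h.one_starT A, h.starT_one A⟩, fun A B => ?_,
    fun A B => ?_, ⟨Φ.symm.toLinearMap ∘ₗ S' ∘ₗ Φ.toLinearMap, fun A => ⟨?_, ?_⟩⟩,
    Φ, hΦ_one, hΦ_mul, hΦ_comul, hΦ_counit⟩
  · simp only [hΦ_mul, mul_assoc]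
  · have h_tensor : ∀ s t, TensorProduct.map Φ.toLinearMap Φ.toLinearMap
        (starT2 (K := K) _ comul GR (s ⊗ₜ[K] t)) =
        TensorProduct.map Φ.toLinearMap Φ.toLinearMap s *
          TensorProduct.map Φ.toLinearMap Φ.toLinearMap t := by
      intro s t
      induction s with
      | zero => simp
      | add s s' hs hs' => simp only [TensorProduct.add_tmul, map_add, hs, hs', add_mul]
      | tmul a b =>
        induction t with
        | zero => simp
        | add t t' ht ht' => simp only [TensorProduct.tmul_add, map_add, ht, ht', mul_add]
        | tmul a' b' => simp [starT2, hΦ_mul]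
    refine (TensorProduct.congr Φ Φ).injective ?_
    change TensorProduct.map Φ.toLinearMap Φ.toLinearMap _ =
      TensorProduct.map Φ.toLinearMap Φ.toLinearMap _
    rw [← hΦ_comul, hΦ_mul, hcomul'_mul, hΦ_comul, hΦ_comul, h_tensor]
  · rw [← hΦ_counit, hΦ_mul, hcounit'_mul, hΦ_counit, hΦ_counit]
  · have h_tensor : ∀ t, TensorProduct.map Φ.toLinearMap Φ.toLinearMap
        (LinearMap.rTensor _ (Φ.symm.toLinearMap ∘ₗ S' ∘ₗ Φ.toLinearMap) t) =
        LinearMap.rTensor _ S' (TensorProduct.map Φ.toLinearMap Φ.toLinearMap t) := by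
      intro t
      induction t with
      | zero => simp
      | tmul a b => simp
      | add s t hs ht => simp only [map_add, hs, ht]
    refine Φ.injective ?_
    rw [h_mul', h_tensor, ← hΦ_comul, (hS' _).1, hΦ_counit, map_smul, hΦ_one]
  · have h_tensor : ∀ t, TensorProduct.map Φ.toLinearMap Φ.toLinearMap
        (LinearMap.lTensor _ (Φ.symm.toLinearMap ∘ₗ S' ∘ₗ Φ.toLinearMap) t) =
        LinearMap.lTensor _ S' (TensorProduct.map Φ.toLinearMap Φ.toLinearMap t) := by
      intro t
      induction t with
      | zero => simp
      | tmul a b => simp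
      | add s t hs ht => simp only [map_add, hs, ht]
    refine Φ.injective ?_
    rw [h_mul', h_tensor, ← hΦ_comul, (hS' _).2, hΦ_counit, map_smul, hΦ_one]
end

section
/- Let H be a connected graded Hopf algebra with a natural growth operator ⊤, and let p_1, …, p_i be primitive elements of H. Then the reduced coproduct satisfies Δ̂(p_i ⊤ ⋯ ⊤ p_1) = Σ_{j=1}^{i−1} (p_i ⊤ ⋯ ⊤ p_{j+1}) ⊗ (p_j ⊤ ⋯ ⊤ p_1). -/
open TensorProduct

section NaturalGrowthPrelude

variable (K H : Type*) [CommRing K] [Ring H] [HopfAlgebra K H]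

/-- The reduced coproduct `Δ̂(x) = Δ(x) − x ⊗ 1 − 1 ⊗ x`. -/
noncomputable def reducedComul : H →ₗ[K] H ⊗[K] H :=
  Coalgebra.comul - (TensorProduct.mk K H H).flip 1 - TensorProduct.mk K H H 1

variable {K H}

/-- `⊤` is a natural growth operator: `Δ̂(x ⊤ y) = x ⊗ y + x⁽¹⁾ ⊗ (x⁽²⁾ ⊤ y)`
for all `x` and all primitive `y` (i.e. `Δ̂(y) = 0`). -/
def IsNaturalGrowth (top : H →ₗ[K] H →ₗ[K] H) : Prop :=
  ∀ x y : H, reducedComul K H y = 0 →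
    reducedComul K H (top x y) =
      x ⊗ₜ[K] y +
        (TensorProduct.map LinearMap.id (top.flip y)) (reducedComul K H x)

/-- A connected grading on a Hopf algebra, compatible with product and coproduct. -/
structure HopfGrading : Type _ where
  grade : ℕ → Submodule K H
  internal : DirectSum.IsInternal grade
  connected : grade 0 = (K ∙ (1 : H))
  mul_mem : ∀ {i j : ℕ} {x y : H}, x ∈ grade i → y ∈ grade j → x * y ∈ grade (i + j)
  comul_mem : ∀ (n : ℕ), ∀ x ∈ grade n,
    Coalgebra.comul (R := K) x ∈
      ⨆ p : {p : ℕ × ℕ // p.1 + p.2 = n},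
        LinearMap.range
          (TensorProduct.map (grade p.1.1).subtype (grade p.1.2).subtype)

/-- `nestAux top p a k = p_{a+k} ⊤ p_{a+k-1} ⊤ ⋯ ⊤ p_a` (left-nested:
`(p_{a+k} ⊤ ⋯ ⊤ p_{a+1}) ⊤ p_a`). -/
noncomputable def nestAux (top : H →ₗ[K] H →ₗ[K] H) (p : ℕ → H) : ℕ → ℕ → H
  | a, 0 => p a
  | a, k + 1 => top (nestAux top p (a + 1) k) (p a)

/-- `nest top p a b = p_b ⊤ p_{b-1} ⊤ ⋯ ⊤ p_a` (for `a ≤ b`),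
i.e. the iterated natural growth product `(p_b ⊤ ⋯ ⊤ p_{a+1}) ⊤ p_a`. -/
noncomputable def nest (top : H →ₗ[K] H →ₗ[K] H) (p : ℕ → H) (a b : ℕ) : H :=
  nestAux top p a (b - a)

end NaturalGrowthPrelude

theorem reducedComul_nestAux_of_primitives {K H : Type*} [CommRing K] [Ring H] [HopfAlgebra K H]
    {top : H →ₗ[K] H →ₗ[K] H} (htop : IsNaturalGrowth top) (p : ℕ → H) (k a : ℕ)
    (hp : ∀ j, a ≤ j → j ≤ a + k → reducedComul K H (p j) = 0) :
    reducedComul K H (nestAux top p a k) =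
      ∑ m ∈ Finset.range k, nestAux top p (a + m + 1) (k - 1 - m) ⊗ₜ[K] nestAux top p a m := by
  induction k generalizing a with
  | zero => simpa [nestAux] using hp a le_rfl le_rfl
  | succ k ih =>
    rw [nestAux, htop _ _ (hp a le_rfl (by lia)),
      ih (a + 1) fun j h₁ h₂ => hp j (by lia) (by lia), Finset.sum_range_succ', add_comm, map_sum]
    congr 1
    refine Finset.sum_congr rfl fun m _ => ?_
    rw [TensorProduct.map_tmul, show a + 1 + m + 1 = a + (m + 1) + 1 by lia,
      show k + 1 - 1 - (m + 1) = k - 1 - m by lia]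
    rfl

/-!
STATEMENT 5: Let H be a connected graded Hopf algebra with a natural growth operator ⊤,
and let p_1, …, p_i be primitive elements of H.  Then
`Δ̂(p_i ⊤ ⋯ ⊤ p_1) = Σ_{j=1}^{i−1} (p_i ⊤ ⋯ ⊤ p_{j+1}) ⊗ (p_j ⊤ ⋯ ⊤ p_1)`.
-/

theorem reducedComul_nest_of_primitives {K H : Type*} [Field K] [CharZero K]
    [Ring H] [HopfAlgebra K H]
    (G : HopfGrading (K := K) (H := H))
    (top : H →ₗ[K] H →ₗ[K] H) (htop : IsNaturalGrowth top)
    (i : ℕ) (hi : 1 ≤ i) (p : ℕ → H)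
    (hp : ∀ j, 1 ≤ j → j ≤ i → reducedComul K H (p j) = 0) :
    reducedComul K H (nest top p 1 i) =
      ∑ j ∈ Finset.Ico 1 i, nest top p (j + 1) i ⊗ₜ[K] nest top p 1 j := by
  unfold nest
  rw [reducedComul_nestAux_of_primitives htop p (i - 1) 1 fun j h₁ h₂ => hp j h₁ (by lia),
    Finset.sum_Ico_eq_sum_range]
  refine Finset.sum_congr rfl fun m _ => ?_
  rw [show i - (1 + m + 1) = i - 1 - 1 - m by lia, Nat.add_sub_cancel_left]
end

section
/- Let H be a connected graded Hopf algebra with a natural growth operator ⊤. Define π: H → H recursively on the grading by π(x) = x − x^(1) ⊤ π(x^(2)) for x in the augmentation ideal (using Sweedler notation for the reduced coproduct). Then Δ̂(π(x)) = 0 for every x in the augmentation ideal, and π acts as the identity on primitive elements; hence π is a projection of the augmentation ideal onto the space P(H) of primitive elements. -/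
open TensorProduct

section ReducedComul

variable {K H : Type*} [CommRing K] [Ring H] [HopfAlgebra K H]

/-- The convolution unit `x ↦ ε(x) 1`, as a linear endomorphism of `H`. -/
noncomputable def unitCounit (K H : Type*) [CommRing K] [Ring H] [HopfAlgebra K H] :
    H →ₗ[K] H :=
  Algebra.linearMap K H ∘ₗ Coalgebra.counit

lemma unitCounit_apply (x : H) :
    unitCounit K H x = (Coalgebra.counit (R := K) x) • (1 : H) := by
  simp [unitCounit, Algebra.algebraMap_eq_smul_one]

lemma reducedComul_apply (x : H) :
    reducedComul K H x = Coalgebra.comul (R := K) x - x ⊗ₜ[K] 1 - 1 ⊗ₜ[K] x := by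
  simp [reducedComul]

lemma reducedComul_one : reducedComul K H 1 = -((1 : H) ⊗ₜ[K] (1 : H)) := by
  simp [reducedComul_apply, Algebra.TensorProduct.one_def]

lemma lTensor_unitCounit_comul (x : H) :
    (unitCounit K H).lTensor H (Coalgebra.comul (R := K) x) = x ⊗ₜ[K] 1 := by
  rw [unitCounit, LinearMap.lTensor_comp_apply, Coalgebra.lTensor_counit_comul]
  simp

lemma rTensor_unitCounit_comul (x : H) :
    (unitCounit K H).rTensor H (Coalgebra.comul (R := K) x) = 1 ⊗ₜ[K] x := by
  rw [unitCounit, LinearMap.rTensor_comp_apply, Coalgebra.rTensor_counit_comul]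
  simp

lemma lTensor_unitCounit_reducedComul (x : H) :
    (unitCounit K H).lTensor H (reducedComul K H x) =
      reducedComul K H (unitCounit K H x) := by
  rw [reducedComul_apply, map_sub, map_sub, lTensor_unitCounit_comul]
  simp [unitCounit_apply, reducedComul_one]

/-- Coassociativity of the reduced coproduct. -/
lemma reducedComul_coassoc (x : H) :
    TensorProduct.assoc K H H H ((reducedComul K H).rTensor H (reducedComul K H x)) =
      (reducedComul K H).lTensor H (reducedComul K H x) := by
  have hl : ∀ t : H ⊗[K] H, TensorProduct.assoc K H H H ((reducedComul K H).rTensor H t) =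
      TensorProduct.assoc K H H H ((Coalgebra.comul (R := K)).rTensor H t)
        - (TensorProduct.mk K H H 1).lTensor H t - (1 : H) ⊗ₜ[K] t := by
    intro t
    induction t with
    | zero => simp
    | add a b ha hb => rw [map_add, map_add, map_add, ha, hb]; simp only [map_add, tmul_add]; abel
    | tmul a b => simp [reducedComul_apply, sub_tmul]
  have hr : ∀ t : H ⊗[K] H, (reducedComul K H).lTensor H t =
      (Coalgebra.comul (R := K)).lTensor H t
        - TensorProduct.assoc K H H H (t ⊗ₜ[K] 1) - (TensorProduct.mk K H H 1).lTensor H t := by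
    intro t
    induction t with
    | zero => simp
    | add a b ha hb => rw [map_add, ha, hb]; simp only [map_add, add_tmul]; abel
    | tmul a b => simp [reducedComul_apply, tmul_sub]
  rw [hl, hr, reducedComul_apply]
  simp only [map_sub, Coalgebra.coassoc_apply, tmul_sub, sub_tmul, LinearMap.rTensor_tmul,
    LinearMap.lTensor_tmul, TensorProduct.mk_apply, assoc_tmul, Bialgebra.comul_one,
    Algebra.TensorProduct.one_def]
  abel

lemma counit_eq_zero_of_reducedComul_eq_zero {x : H} (hx : reducedComul K H x = 0) :
    Coalgebra.counit (R := K) x = 0 := by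
  have h := lTensor_unitCounit_reducedComul (K := K) x
  rw [hx, map_zero, unitCounit_apply, map_smul, reducedComul_one] at h
  have h' := congrArg (LinearMap.mul' K K ∘ₗ
    TensorProduct.map (Coalgebra.counit (R := K)) (Coalgebra.counit (R := K))) h
  simpa using h'.symm

/-- For `f` with primitive values, `Δ̂` of `x⁽¹⁾ ⊤ f(x⁽²⁾)`. -/
lemma IsNaturalGrowth.reducedComul_lift {top : H →ₗ[K] H →ₗ[K] H} (htop : IsNaturalGrowth top)
    {f : H →ₗ[K] H} (hf : ∀ x, reducedComul K H (f x) = 0) (t : H ⊗[K] H) :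
    reducedComul K H (TensorProduct.lift top (f.lTensor H t)) =
      f.lTensor H t + (TensorProduct.lift top ∘ₗ f.lTensor H).lTensor H
        (TensorProduct.assoc K H H H ((reducedComul K H).rTensor H t)) := by
  induction t with
  | zero => simp
  | add a b ha hb => simp only [map_add, ha, hb]; abel
  | tmul a b =>
    simp only [LinearMap.lTensor_tmul, LinearMap.rTensor_tmul, lift.tmul]
    rw [htop _ _ (hf b)]
    congr 1
    generalize reducedComul K H a = s
    induction s with
    | zero => simp
    | add u v hu hv => simp only [map_add, add_tmul, hu, hv]
    | tmul u v => simp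

/-- The iterates converging to the solution of `π(x) = x - x⁽¹⁾ ⊤ π(x⁽²⁾)`. -/
noncomputable def primitiveApprox (top : H →ₗ[K] H →ₗ[K] H) : ℕ → H →ₗ[K] H
  | 0 => 0
  | n + 1 => LinearMap.id - unitCounit K H -
      TensorProduct.lift top ∘ₗ (primitiveApprox top n).lTensor H ∘ₗ reducedComul K H

lemma primitiveApprox_succ (top : H →ₗ[K] H →ₗ[K] H) (n : ℕ) (x : H) :
    primitiveApprox top (n + 1) x = x - unitCounit K H x -
      TensorProduct.lift top ((primitiveApprox top n).lTensor H (reducedComul K H x)) :=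
  rfl

lemma primitiveApprox_one (top : H →ₗ[K] H →ₗ[K] H) (n : ℕ) : primitiveApprox top n 1 = 0 := by
  induction n with
  | zero => rfl
  | succ n ih => simp [primitiveApprox_succ, unitCounit_apply, reducedComul_one, ih]

end ReducedComul

namespace HopfGrading

variable {K H : Type*} [CommRing K] [Ring H] [HopfAlgebra K H]

lemma exists_linearMap (G : HopfGrading (K := K) (H := H)) (f : ℕ → H →ₗ[K] H) :
    ∃ g : H →ₗ[K] H, ∀ n, ∀ x ∈ G.grade n, g x = f n x := by
  let e := LinearEquiv.ofBijective (DirectSum.coeLinearMap G.grade) G.internal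
  refine ⟨DirectSum.toModule K ℕ H (fun n => f n ∘ₗ (G.grade n).subtype) ∘ₗ e.symm.toLinearMap,
    fun n x hx => ?_⟩
  have h : e.symm x = DirectSum.lof K ℕ (fun n => G.grade n) n ⟨x, hx⟩ := by
    rw [LinearEquiv.symm_apply_eq]
    exact (DirectSum.coeLinearMap_lof (A := G.grade) n ⟨x, hx⟩).symm
  simp [h]

section

variable (G : HopfGrading (K := K) (H := H))

lemma linearMap_ext {M : Type*} [AddCommMonoid M] [Module K M] {f g : H →ₗ[K] M}
    (h : ∀ n, ∀ x ∈ G.grade n, f x = g x) : f = g := by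
  ext x
  have hx : x ∈ ⨆ n, G.grade n := by
    rw [G.internal.submodule_iSup_eq_top]; trivial
  induction hx using Submodule.iSup_induction' with
  | mem n x hx => exact h n x hx
  | zero => simp
  | add x y _ _ hx hy => simp [hx, hy]

lemma map_comul_eq_map_comul {f f' g g' : H →ₗ[K] H} {n : ℕ}
    (h : ∀ i j, i + j = n → ∀ a ∈ G.grade i, ∀ b ∈ G.grade j,
      f a ⊗ₜ[K] g b = f' a ⊗ₜ[K] g' b) {x : H} (hx : x ∈ G.grade n) :
    TensorProduct.map f g (Coalgebra.comul (R := K) x) =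
      TensorProduct.map f' g' (Coalgebra.comul (R := K) x) := by
  have ht := G.comul_mem n x hx
  generalize Coalgebra.comul (R := K) x = t at ht
  induction ht using Submodule.iSup_induction' with
  | mem p t ht =>
    obtain ⟨s, rfl⟩ := ht
    induction s with
    | zero => simp
    | add u v hu hv => simp only [map_add, hu, hv]
    | tmul a b => exact h _ _ p.2 a a.2 b b.2
  | zero => simp
  | add u v _ _ hu hv => simp only [map_add, hu, hv]

lemma exists_smul_one_of_mem {x : H} (hx : x ∈ G.grade 0) : ∃ c : K, c • (1 : H) = x := by
  rw [G.connected] at hx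
  exact Submodule.mem_span_singleton.1 hx

lemma one_mem : (1 : H) ∈ G.grade 0 := by
  rw [G.connected]
  exact Submodule.mem_span_singleton_self _

/-- The second tensor factors of `Δ̂ x` have degree smaller than that of `x`. -/
lemma lTensor_reducedComul_eq_zero {d : H →ₗ[K] H} {n : ℕ} (hn : 0 < n)
    (hd : ∀ j < n, ∀ y ∈ G.grade j, d y = 0) {x : H} (hx : x ∈ G.grade n) :
    d.lTensor H (reducedComul K H x) = 0 := by
  have hproj (i : ℕ) := G.exists_linearMap (fun j => if j = i then LinearMap.id else 0)
  choose p hp using hproj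
  have hp_self {i : ℕ} {y : H} (hy : y ∈ G.grade i) : p i y = y := by simp [hp i i y hy]
  have hp_ne {i j : ℕ} (hij : j ≠ i) {y : H} (hy : y ∈ G.grade j) : p i y = 0 := by
    simp [hp i j y hy, hij]
  have hu : unitCounit K H ∘ₗ p 0 = p 0 := by
    refine G.linearMap_ext fun j y hy => ?_
    by_cases hj : j = 0
    · subst hj
      obtain ⟨c, rfl⟩ := G.exists_smul_one_of_mem hy
      simp [hp_self hy, hp_self G.one_mem, unitCounit_apply]
    · simp [hp_ne hj hy]
  have h_zero_left : TensorProduct.map (p 0) LinearMap.id (Coalgebra.comul (R := K) x) =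
      1 ⊗ₜ[K] x := by
    have h : TensorProduct.map (p 0) LinearMap.id (Coalgebra.comul (R := K) x) =
        TensorProduct.map LinearMap.id (p n) (Coalgebra.comul (R := K) x) := by
      refine G.map_comul_eq_map_comul (fun i j hij a ha b hb => ?_) hx
      by_cases hi : i = 0
      · obtain rfl : j = n := by omega
        subst hi
        simp [hp_self ha, hp_self hb]
      · simp [hp_ne hi ha, hp_ne (show j ≠ n by omega) hb]
    calc _ = (unitCounit K H).rTensor H
          (TensorProduct.map (p 0) LinearMap.id (Coalgebra.comul (R := K) x)) := by
          rw [LinearMap.rTensor, TensorProduct.map_map, hu, LinearMap.id_comp]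
      _ = (p n).lTensor H ((unitCounit K H).rTensor H (Coalgebra.comul (R := K) x)) := by
          rw [h, LinearMap.rTensor, LinearMap.lTensor, TensorProduct.map_map,
            TensorProduct.map_map]
          simp only [LinearMap.id_comp, LinearMap.comp_id]
      _ = _ := by rw [rTensor_unitCounit_comul]; simp [hp_self hx]
  have h_comul : d.lTensor H (Coalgebra.comul (R := K) x) = 1 ⊗ₜ[K] d x := by
    calc _ = TensorProduct.map (p 0) d (Coalgebra.comul (R := K) x) := by
          refine G.map_comul_eq_map_comul (fun i j hij a ha b hb => ?_) hx
          by_cases hi : i = 0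
          · subst hi
            simp [hp_self ha]
          · simp [hd j (by omega) b hb]
      _ = d.lTensor H (TensorProduct.map (p 0) LinearMap.id (Coalgebra.comul (R := K) x)) := by
          rw [LinearMap.lTensor, TensorProduct.map_map, LinearMap.id_comp, LinearMap.comp_id]
      _ = _ := by rw [h_zero_left]; simp
  rw [reducedComul_apply, map_sub, map_sub, h_comul]
  simp [hd 0 hn 1 G.one_mem]

lemma lTensor_reducedComul_congr {f g : H →ₗ[K] H} {n : ℕ} (hn : 0 < n)
    (h : ∀ j < n, ∀ y ∈ G.grade j, f y = g y) {x : H} (hx : x ∈ G.grade n) :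
    f.lTensor H (reducedComul K H x) = g.lTensor H (reducedComul K H x) := by
  rw [← sub_eq_zero, ← LinearMap.sub_apply, ← LinearMap.lTensor_sub]
  exact G.lTensor_reducedComul_eq_zero hn (fun j hj y hy => by simp [h j hj y hy]) hx

lemma primitiveApprox_eq (top : H →ₗ[K] H →ₗ[K] H) {n m : ℕ} (hm : n < m) {x : H}
    (hx : x ∈ G.grade n) : primitiveApprox top m x = primitiveApprox top (n + 1) x := by
  induction n using Nat.strong_induction_on generalizing m x with
  | _ n ih =>
    obtain rfl | hn := n.eq_zero_or_pos
    · obtain ⟨c, rfl⟩ := G.exists_smul_one_of_mem hx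
      simp [primitiveApprox_one]
    · obtain ⟨m, rfl⟩ : ∃ k, m = k + 1 := ⟨m - 1, by omega⟩
      rw [primitiveApprox_succ, primitiveApprox_succ,
        G.lTensor_reducedComul_congr hn (g := primitiveApprox top n) (fun j hj y hy => ?_) hx]
      rw [ih j hj (by omega) hy, ih j hj hj hy]

end

lemma exists_recursion (G : HopfGrading (K := K) (H := H)) (top : H →ₗ[K] H →ₗ[K] H) :
    ∃ π : H →ₗ[K] H, π 1 = 0 ∧ ∀ x, π x = x - unitCounit K H x -
      TensorProduct.lift top (π.lTensor H (reducedComul K H x)) := by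
  obtain ⟨π, hπ⟩ := G.exists_linearMap (fun n => primitiveApprox top (n + 1))
  have h_one : π 1 = 0 := by rw [hπ 0 1 G.one_mem, primitiveApprox_one]
  refine ⟨π, h_one, fun x => ?_⟩
  suffices h : π = LinearMap.id - unitCounit K H -
      TensorProduct.lift top ∘ₗ π.lTensor H ∘ₗ reducedComul K H from
    LinearMap.congr_fun h x
  refine G.linearMap_ext fun n x hx => ?_
  obtain rfl | hn := n.eq_zero_or_pos
  · obtain ⟨c, rfl⟩ := G.exists_smul_one_of_mem hx
    simp [h_one, unitCounit_apply, reducedComul_one]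
  · rw [hπ n x hx, primitiveApprox_succ, G.lTensor_reducedComul_congr hn (g := π) ?_ hx]
    · rfl
    · intro j hj y hy
      rw [hπ j y hy, G.primitiveApprox_eq top hj hy]

lemma reducedComul_recursion_eq_zero (G : HopfGrading (K := K) (H := H))
    {top : H →ₗ[K] H →ₗ[K] H} (htop : IsNaturalGrowth top) {π : H →ₗ[K] H} (h_one : π 1 = 0)
    (hπ : ∀ x, π x = x - unitCounit K H x -
      TensorProduct.lift top (π.lTensor H (reducedComul K H x))) (x : H) :
    reducedComul K H (π x) = 0 := by
  suffices h : reducedComul K H ∘ₗ π = 0 from LinearMap.congr_fun h x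
  refine G.linearMap_ext fun n x hx => ?_
  rw [LinearMap.comp_apply, LinearMap.zero_apply]
  induction n using Nat.strong_induction_on generalizing x with
  | _ n ih =>
    obtain rfl | hn := n.eq_zero_or_pos
    · obtain ⟨c, rfl⟩ := G.exists_smul_one_of_mem hx
      simp [h_one]
    obtain ⟨ρ, hρ⟩ := G.exists_linearMap (fun j => if j < n then π else 0)
    have hρ_prim : ∀ y, reducedComul K H (ρ y) = 0 := by
      suffices h : reducedComul K H ∘ₗ ρ = 0 from LinearMap.congr_fun h
      refine G.linearMap_ext fun j y hy => ?_
      rw [LinearMap.comp_apply, LinearMap.zero_apply, hρ j y hy]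
      split_ifs with hj
      · exact ih j hj y hy
      · simp
    have hρπ : ρ.lTensor H (reducedComul K H x) = π.lTensor H (reducedComul K H x) :=
      G.lTensor_reducedComul_congr hn (fun j hj y hy => by simp [hρ j y hy, hj]) hx
    have h_swap (f : H →ₗ[K] H) (t : H ⊗[K] H) :
        (TensorProduct.lift top ∘ₗ f.lTensor H).lTensor H
          (TensorProduct.assoc K H H H ((reducedComul K H).rTensor H t)) =
        (TensorProduct.lift top).lTensor H
          (TensorProduct.assoc K H H H ((reducedComul K H).rTensor H (f.lTensor H t))) := by
      induction t with
      | zero => simp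
      | add a b ha hb => simp only [map_add, ha, hb]
      | tmul a b =>
        simp only [LinearMap.lTensor_tmul, LinearMap.rTensor_tmul]
        generalize reducedComul K H a = s
        induction s with
        | zero => simp
        | add u v hu hv => simp only [map_add, add_tmul, hu, hv]
        | tmul u v => simp
    have h_rec : TensorProduct.lift top ∘ₗ π.lTensor H ∘ₗ reducedComul K H =
        LinearMap.id - unitCounit K H - π := by
      ext y
      simp [hπ y]
    have h_growth := htop.reducedComul_lift hρ_prim (reducedComul K H x)
    rw [h_swap, hρπ, ← h_swap, reducedComul_coassoc, ← LinearMap.lTensor_comp_apply,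
      LinearMap.comp_assoc, h_rec, LinearMap.lTensor_sub, LinearMap.lTensor_sub,
      LinearMap.sub_apply, LinearMap.sub_apply, lTensor_unitCounit_reducedComul,
      LinearMap.lTensor_id, LinearMap.id_apply] at h_growth
    rw [hπ x, map_sub, map_sub, h_growth]
    abel

end HopfGrading

/-!
STATEMENT 6: Let H be a connected graded Hopf algebra with a natural growth operator ⊤.
Define π : H → H recursively by π(x) = x − x⁽¹⁾ ⊤ π(x⁽²⁾) on the augmentation ideal.
Then Δ̂(π(x)) = 0 for every x in the augmentation ideal, and π is the identity on
primitive elements; hence π is a projection of the augmentation ideal onto P(H).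
-/

theorem projection_onto_primitives {K H : Type*} [Field K] [CharZero K]
    [Ring H] [HopfAlgebra K H]
    (G : HopfGrading (K := K) (H := H))
    (top : H →ₗ[K] H →ₗ[K] H) (htop : IsNaturalGrowth top) :
    ∃ π : H →ₗ[K] H,
      -- the defining recursion π(x) = x − x⁽¹⁾ ⊤ π(x⁽²⁾) on the augmentation ideal
      (∀ x : H, Coalgebra.counit (R := K) x = 0 →
        π x = x - TensorProduct.lift top
          ((TensorProduct.map LinearMap.id π) (reducedComul K H x))) ∧
      -- π lands in the primitive elements
      (∀ x : H, Coalgebra.counit (R := K) x = 0 → reducedComul K H (π x) = 0) ∧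
      -- π is the identity on primitive elements
      (∀ x : H, reducedComul K H x = 0 → π x = x) := by
  obtain ⟨π, h_one, hπ⟩ := G.exists_recursion top
  have h_rec : ∀ x : H, Coalgebra.counit (R := K) x = 0 →
      π x = x - TensorProduct.lift top
        ((TensorProduct.map LinearMap.id π) (reducedComul K H x)) := by
    intro x hx
    have h := hπ x
    rwa [unitCounit_apply, hx, zero_smul, sub_zero] at h
  refine ⟨π, h_rec, fun x _ => G.reducedComul_recursion_eq_zero htop h_one hπ x, fun x hx => ?_⟩
  rw [h_rec x (counit_eq_zero_of_reducedComul_eq_zero hx), hx, map_zero, map_zero, sub_zero]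
end

section
/- Let H be a connected graded Hopf algebra with a natural growth operator ⊤, and let (C, Δ_C) be a finite-dimensional H-comodule. If dim C = 1, then C is trivial, i.e. Δ_C(x) = 1 ⊗ x for all x ∈ C. If dim C = n + 1 ≥ 2, then there exists a family (p_{i,j})_{1 ≤ i ≤ j ≤ n} of primitive elements of H such that C is isomorphic as an H-comodule to C_{(p_{i,j})}. -/
open TensorProduct

/-!
STATEMENT 10: Let H be a connected graded Hopf algebra with a natural growth operator ⊤
and (C, Δ_C) a finite-dimensional H-comodule.  If dim C = 1 then C is trivial,
Δ_C(x) = 1 ⊗ x.  If dim C = n + 1 ≥ 2 then there is a family (p_{i,j})_{1≤i≤j≤n} of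
primitive elements such that C is isomorphic as an H-comodule to C_{(p_{i,j})}.
-/

section Comodule

variable {K H : Type*} [Field K] [CharZero K] [Ring H] [HopfAlgebra K H]

/-- Iterated natural growth product attached to a decomposition of `[a,b]` given by a
sorted list of interior cut points. -/
noncomputable def decompProd (top : H →ₗ[K] H →ₗ[K] H) (p : ℕ → ℕ → H) :
    ℕ → ℕ → List ℕ → H
  | a, b, [] => p a b
  | a, b, j :: L => top (decompProd top p (j + 1) b L) (p a j)

/-- Sum over all decompositions of the interval `[a,b]`. -/
noncomputable def decompSum (top : H →ₗ[K] H →ₗ[K] H) (p : ℕ → ℕ → H) (a b : ℕ) : H :=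
  ∑ c ∈ (Finset.Ico a b).powerset, decompProd top p a b (c.sort (· ≤ ·))

/-- The coaction of the model comodule `C_{(p_{i,j})}` on `K^{n+1}`. -/
noncomputable def comoduleCoaction (top : H →ₗ[K] H →ₗ[K] H) (p : ℕ → ℕ → H) (n : ℕ) :
    (Fin (n + 1) → K) →ₗ[K] H ⊗[K] (Fin (n + 1) → K) :=
  (Pi.basisFun K (Fin (n + 1))).constr ℕ fun i =>
    (∑ j ∈ Finset.univ.filter (fun j : Fin (n + 1) => j < i),
      decompSum top p ((j : ℕ) + 1) (i : ℕ) ⊗ₜ[K] Pi.single j (1 : K)) +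
    (1 : H) ⊗ₜ[K] Pi.single i (1 : K)

end Comodule

section GradedProjections

variable {K H : Type*} [Field K] [Ring H] [HopfAlgebra K H]

/-- The homogeneous projections attached to a connected Hopf grading. -/
theorem HopfGrading.exists_projections (G : HopfGrading (K := K) (H := H)) :
    ∃ π : ℕ → H →ₗ[K] H,
      (∀ x, π 0 x ∈ (K ∙ (1 : H))) ∧
      (∀ x, ∃ N, ∀ M, N ≤ M → ∑ k ∈ Finset.range M, π k x = x ∧ π M x = 0) ∧
      ∀ a b, TensorProduct.map (π a) (π b) ∘ₗ Coalgebra.comul =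
        TensorProduct.map (π a) (π b) ∘ₗ Coalgebra.comul ∘ₗ π (a + b) := by
  classical
  let _ := G.internal.chooseDecomposition
  let π : ℕ → H →ₗ[K] H := fun n => (G.grade n).subtype ∘ₗ
    DirectSum.component K ℕ (fun i => G.grade i) n ∘ₗ
      (DirectSum.decomposeLinearEquiv G.grade).toLinearMap
  have hπ (n x) : π n x = (DirectSum.decompose G.grade x n : H) := rfl
  have hmem (n x) : π n x ∈ G.grade n := by rw [hπ]; exact Subtype.coe_prop _
  have hsame (n) (x) (hx : x ∈ G.grade n) : π n x = x := DirectSum.decompose_of_mem_same _ hx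
  have hne (m n) (x) (hx : x ∈ G.grade n) (h : n ≠ m) : π m x = 0 :=
    DirectSum.decompose_of_mem_ne _ hx h
  have hsum (x) : ∃ N, ∀ M, N ≤ M → ∑ k ∈ Finset.range M, π k x = x ∧ π M x = 0 := by
    refine ⟨(DirectSum.decompose G.grade x).support.sup id + 1, fun M hM => ?_⟩
    have hzero (k) (hk : k ∉ (DirectSum.decompose G.grade x).support) : π k x = 0 := by
      rw [hπ, DFinsupp.notMem_support_iff.mp hk, ZeroMemClass.coe_zero]
    have hlt (k) (hk : k ∈ (DirectSum.decompose G.grade x).support) : k < M :=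
      (Nat.lt_succ_of_le (Finset.le_sup (f := id) hk)).trans_le hM
    refine ⟨?_, hzero M fun h => (hlt M h).false⟩
    conv_rhs => rw [← DirectSum.sum_support_decompose G.grade x]
    exact (Finset.sum_subset (fun k hk => Finset.mem_range.mpr (hlt k hk))
      fun k _ hk => hzero k hk).symm
  refine ⟨π, fun x => G.connected ▸ hmem 0 x, hsum, fun a b => LinearMap.ext fun x => ?_⟩
  have hhom (n) (y) (hy : y ∈ G.grade n) :
      TensorProduct.map (π a) (π b) (Coalgebra.comul (R := K) y) =
        TensorProduct.map (π a) (π b) (Coalgebra.comul (R := K) (π (a + b) y)) := by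
    by_cases h : n = a + b
    · rw [hsame _ _ (h ▸ hy)]
    · rw [hne _ _ _ hy h, map_zero, map_zero, ← LinearMap.mem_ker]
      refine (iSup_le fun p => ?_ : _ ≤ LinearMap.ker _) (G.comul_mem n y hy)
      rintro _ ⟨t, rfl⟩
      rw [LinearMap.mem_ker, ← LinearMap.comp_apply, ← TensorProduct.map_comp]
      have hp := p.2
      by_cases ha : p.1.1 = a
      · have : π b ∘ₗ (G.grade p.1.2).subtype = 0 :=
          LinearMap.ext fun u => hne _ _ _ u.2 (by omega)
        rw [this, TensorProduct.map_zero_right, LinearMap.zero_apply]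
      · have : π a ∘ₗ (G.grade p.1.1).subtype = 0 := LinearMap.ext fun u => hne _ _ _ u.2 ha
        rw [this, TensorProduct.map_zero_left, LinearMap.zero_apply]
  obtain ⟨N, hN⟩ := hsum x
  rw [← (hN N le_rfl).1]
  simp only [LinearMap.comp_apply, map_sum]
  exact Finset.sum_congr rfl fun k _ => hhom k _ (hmem k x)

end GradedProjections

section Coinvariants

variable {K H : Type*} [Field K] [Ring H] [HopfAlgebra K H]

/-- Functionals on the left factor separate the elements of a tensor product. -/
theorem exists_lid_map_ne_zero {V Q : Type*} [AddCommGroup V] [Module K V]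
    [AddCommGroup Q] [Module K Q] {w : V ⊗[K] Q} (hw : w ≠ 0) :
    ∃ f : V →ₗ[K] K,
      TensorProduct.lid K Q (TensorProduct.map f (LinearMap.id : Q →ₗ[K] Q) w) ≠ 0 := by
  classical
  let B := Module.Basis.ofVectorSpace K V
  by_contra! h
  refine hw ((TensorProduct.equivFinsuppOfBasisLeft B).map_eq_zero_iff.mp (Finsupp.ext fun i => ?_))
  have key : Finsupp.lapply i ∘ₗ (TensorProduct.equivFinsuppOfBasisLeft B).toLinearMap =
      (TensorProduct.lid K Q).toLinearMap ∘ₗ TensorProduct.map (B.coord i) LinearMap.id :=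
    TensorProduct.ext' fun x y => by simp
  exact (LinearMap.congr_fun key w).trans (h (B.coord i))

/-- Modulo a proper subspace, a comodule over a connected graded Hopf algebra has a nonzero
coinvariant. -/
theorem HopfGrading.exists_coinvariant_mkQ (G : HopfGrading (K := K) (H := H))
    {C : Type*} [AddCommGroup C] [Module K C] (ΔC : C →ₗ[K] H ⊗[K] C)
    (hcounit : (TensorProduct.lid K C).toLinearMap ∘ₗ
        (TensorProduct.map (Coalgebra.counit (R := K)) LinearMap.id) ∘ₗ ΔC = LinearMap.id)
    (hcoassoc : (TensorProduct.assoc K H H C).toLinearMap ∘ₗ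
        (TensorProduct.map (Coalgebra.comul (R := K)) LinearMap.id) ∘ₗ ΔC =
      (TensorProduct.map LinearMap.id ΔC) ∘ₗ ΔC)
    {W : Submodule K C} (hW : W ≠ ⊤) :
    ∃ c ∉ W, TensorProduct.map LinearMap.id W.mkQ (ΔC c) = (1 : H) ⊗ₜ[K] W.mkQ c := by
  obtain ⟨π, hπ0, hπsum, hπcomul⟩ := G.exists_projections
  have hcounitQ (y : C) : TensorProduct.lid K (C ⧸ W) (TensorProduct.map
      (Coalgebra.counit (R := K)) LinearMap.id
        (TensorProduct.map LinearMap.id W.mkQ (ΔC y))) = W.mkQ y := by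
    have key : (TensorProduct.lid K (C ⧸ W)).toLinearMap ∘ₗ TensorProduct.map
        (Coalgebra.counit (R := K)) LinearMap.id ∘ₗ
          TensorProduct.map (LinearMap.id : H →ₗ[K] H) W.mkQ =
        W.mkQ ∘ₗ (TensorProduct.lid K C).toLinearMap ∘ₗ
          TensorProduct.map (Coalgebra.counit (R := K)) LinearMap.id :=
      TensorProduct.ext' fun h c => by simp
    have := LinearMap.congr_fun key (ΔC y)
    have h2 := LinearMap.congr_fun hcounit y
    simp only [LinearMap.comp_apply, LinearEquiv.coe_coe, LinearMap.id_apply] at this h2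
    rw [this, h2]
  have htensor (z : H ⊗[K] (C ⧸ W)) : ∃ N, ∀ M, N ≤ M →
      ∑ k ∈ Finset.range M, TensorProduct.map (π k) LinearMap.id z = z ∧
        TensorProduct.map (π M) LinearMap.id z = 0 := by
    induction z with
    | zero => exact ⟨0, by simp⟩
    | tmul h q =>
      obtain ⟨N, hN⟩ := hπsum h
      refine ⟨N, fun M hM => ⟨?_, ?_⟩⟩
      · simp only [TensorProduct.map_tmul, ← TensorProduct.sum_tmul, (hN M hM).1,
          LinearMap.id_apply]
      · rw [TensorProduct.map_tmul, (hN M hM).2, TensorProduct.zero_tmul]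
    | add u v hu hv =>
      obtain ⟨N, hN⟩ := hu
      obtain ⟨N', hN'⟩ := hv
      refine ⟨max N N', fun M hM => ?_⟩
      have h1 := hN M ((le_max_left _ _).trans hM)
      have h2 := hN' M ((le_max_right _ _).trans hM)
      simp only [map_add, Finset.sum_add_distrib, h1, h2, add_zero, and_self]
  have hmapQ (k : ℕ) (z : H ⊗[K] C) : TensorProduct.map (π k) LinearMap.id
      (TensorProduct.map LinearMap.id W.mkQ z) = TensorProduct.map (π k) W.mkQ z := by
    rw [← LinearMap.comp_apply, ← TensorProduct.map_comp, LinearMap.comp_id, LinearMap.id_comp]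
  obtain ⟨x, hx⟩ : ∃ x, x ∉ W := by
    by_contra! h
    exact hW (eq_top_iff.mpr fun y _ => h y)
  obtain ⟨n, hn, hmax⟩ : ∃ n, TensorProduct.map (π n) W.mkQ (ΔC x) ≠ 0 ∧
      ∀ m, n < m → TensorProduct.map (π m) W.mkQ (ΔC x) = 0 := by
    classical
    obtain ⟨N, hN⟩ := htensor (TensorProduct.map LinearMap.id W.mkQ (ΔC x))
    have hex : ∃ N, ∀ m, N ≤ m → TensorProduct.map (π m) W.mkQ (ΔC x) = 0 :=
      ⟨N, fun m hm => hmapQ m _ ▸ (hN m hm).2⟩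
    have hspec := Nat.find_spec hex
    have hmin := fun m => Nat.find_min hex (m := m)
    generalize Nat.find hex = k at hspec hmin
    rcases k with _ | n
    · refine absurd ?_ hx
      rw [← W.ker_mkQ, LinearMap.mem_ker, ← hcounitQ, ← (hN N le_rfl).1,
        Finset.sum_eq_zero fun k _ => (hmapQ k _).trans (hspec k k.zero_le), map_zero, map_zero]
    · refine ⟨n, fun h => hmin n n.lt_succ_self fun m hm => ?_, fun m hm => hspec m hm⟩
      rcases hm.eq_or_lt with rfl | hm
      exacts [h, hspec m hm]
  obtain ⟨f, hf⟩ := exists_lid_map_ne_zero hn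
  refine ⟨TensorProduct.lid K C (TensorProduct.map (f ∘ₗ π n) LinearMap.id (ΔC x)), ?_, ?_⟩
  · rw [← W.ker_mkQ, LinearMap.mem_ker]
    convert hf
    have key : W.mkQ ∘ₗ (TensorProduct.lid K C).toLinearMap ∘ₗ
        TensorProduct.map (f ∘ₗ π n) LinearMap.id =
        (TensorProduct.lid K (C ⧸ W)).toLinearMap ∘ₗ TensorProduct.map f LinearMap.id ∘ₗ
          TensorProduct.map (π n) W.mkQ :=
      TensorProduct.ext' fun h c => by simp
    exact LinearMap.congr_fun key (ΔC x)
  set c := TensorProduct.lid K C (TensorProduct.map (f ∘ₗ π n) LinearMap.id (ΔC x)) with hc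
  have hpos (m : ℕ) (hm : 0 < m) : TensorProduct.map (π m) W.mkQ (ΔC c) = 0 := by
    have h1 : TensorProduct.map (π m) W.mkQ ∘ₗ ΔC ∘ₗ (TensorProduct.lid K C).toLinearMap ∘ₗ
        TensorProduct.map (f ∘ₗ π n) LinearMap.id =
        (TensorProduct.lid K _).toLinearMap ∘ₗ
          TensorProduct.map (f ∘ₗ π n) (TensorProduct.map (π m) W.mkQ) ∘ₗ
            TensorProduct.map LinearMap.id ΔC :=
      TensorProduct.ext' fun h c => by simp
    let L : H ⊗[K] H →ₗ[K] H := (TensorProduct.lid K H).toLinearMap ∘ₗ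
      TensorProduct.map f LinearMap.id
    have h2 : (TensorProduct.lid K _).toLinearMap ∘ₗ
          TensorProduct.map (f ∘ₗ π n) (TensorProduct.map (π m) W.mkQ) ∘ₗ
            (TensorProduct.assoc K H H C).toLinearMap =
        TensorProduct.map (L ∘ₗ TensorProduct.map (π n) (π m)) W.mkQ :=
      TensorProduct.ext_threefold fun h h' c => by simp [L, TensorProduct.smul_tmul']
    have h3 : TensorProduct.map (L ∘ₗ TensorProduct.map (π n) (π m)) W.mkQ ∘ₗ
        TensorProduct.map (Coalgebra.comul (R := K)) LinearMap.id =
        TensorProduct.map (L ∘ₗ TensorProduct.map (π n) (π m) ∘ₗ Coalgebra.comul)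
          LinearMap.id ∘ₗ TensorProduct.map (π (n + m)) W.mkQ := by
      rw [← TensorProduct.map_comp, ← TensorProduct.map_comp, LinearMap.comp_id, LinearMap.id_comp]
      exact congrArg (TensorProduct.map · W.mkQ) (congrArg (L ∘ₗ ·) (hπcomul n m))
    have e1 := LinearMap.congr_fun h1 (ΔC x)
    have e2 := LinearMap.congr_fun h2 (TensorProduct.map Coalgebra.comul LinearMap.id (ΔC x))
    have e3 := LinearMap.congr_fun h3 (ΔC x)
    have e4 := LinearMap.congr_fun hcoassoc x
    simp only [LinearMap.comp_apply, LinearEquiv.coe_coe] at e1 e2 e3 e4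
    rw [hc, e1, ← e4, e2, e3, hmax _ (by omega), map_zero]
  obtain ⟨N, hN⟩ := htensor (TensorProduct.map LinearMap.id W.mkQ (ΔC c))
  have hzero := (hN (N + 1) N.le_succ).1
  rw [Finset.sum_range_succ', Finset.sum_eq_zero
    fun k _ => (hmapQ (k + 1) _).trans (hpos (k + 1) k.succ_pos), zero_add] at hzero
  have hone (z : H ⊗[K] (C ⧸ W)) :
      ∃ q, TensorProduct.map (π 0) LinearMap.id z = (1 : H) ⊗ₜ[K] q := by
    induction z with
    | zero => exact ⟨0, by simp⟩
    | tmul h q =>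
      obtain ⟨r, hr⟩ := Submodule.mem_span_singleton.mp (hπ0 h)
      exact ⟨r • q, by rw [TensorProduct.map_tmul, ← hr, TensorProduct.smul_tmul,
        LinearMap.id_apply]⟩
    | add u v hu hv =>
      obtain ⟨q, hq⟩ := hu
      obtain ⟨q', hq'⟩ := hv
      exact ⟨q + q', by rw [map_add, hq, hq', TensorProduct.tmul_add]⟩
  obtain ⟨q, hq⟩ := hone (TensorProduct.map LinearMap.id W.mkQ (ΔC c))
  rw [hzero] at hq
  have := hcounitQ c
  rw [hq, TensorProduct.map_tmul, Bialgebra.counit_one, TensorProduct.lid_tmul, one_smul,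
    LinearMap.id_apply] at this
  rw [hq, this]

/-- A finite-dimensional comodule over a connected graded Hopf algebra has a basis in which the
coaction is unitriangular. -/
theorem HopfGrading.exists_unitriangular_basis (G : HopfGrading (K := K) (H := H))
    {C : Type*} [AddCommGroup C] [Module K C] [FiniteDimensional K C] (ΔC : C →ₗ[K] H ⊗[K] C)
    (hcounit : (TensorProduct.lid K C).toLinearMap ∘ₗ
        (TensorProduct.map (Coalgebra.counit (R := K)) LinearMap.id) ∘ₗ ΔC = LinearMap.id)
    (hcoassoc : (TensorProduct.assoc K H H C).toLinearMap ∘ₗ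
        (TensorProduct.map (Coalgebra.comul (R := K)) LinearMap.id) ∘ₗ ΔC =
      (TensorProduct.map LinearMap.id ΔC) ∘ₗ ΔC)
    {d : ℕ} (hd : Module.finrank K C = d) :
    ∃ (b : Module.Basis (Fin d) K C) (M : Fin d → Fin d → H),
      (∀ i, ΔC (b i) = ∑ j, M i j ⊗ₜ[K] b j) ∧ (∀ i, M i i = 1) ∧
      (∀ i j, i < j → M i j = 0) ∧
      ∀ i j, Coalgebra.comul (R := K) (M i j) = ∑ k, M i k ⊗ₜ[K] M k j := by
  have hcoinv (V : Submodule K C) (u : C →ₗ[K] K) (hu : V ≤ LinearMap.ker u) {c : C}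
      (hc : TensorProduct.map LinearMap.id V.mkQ (ΔC c) = (1 : H) ⊗ₜ[K] V.mkQ c) :
      TensorProduct.rid K H (TensorProduct.map LinearMap.id u (ΔC c)) = u c • (1 : H) := by
    have h := congrArg (TensorProduct.map (LinearMap.id : H →ₗ[K] H) (V.liftQ u hu)) hc
    rw [← LinearMap.comp_apply (TensorProduct.map _ _), ← TensorProduct.map_comp,
      Submodule.liftQ_mkQ, LinearMap.comp_id] at h
    rw [h, TensorProduct.map_tmul, TensorProduct.rid_tmul, Submodule.mkQ_apply,
      Submodule.liftQ_apply, LinearMap.id_apply]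
  have hex (W : Submodule K C) : ∃ c, W ≠ ⊤ → c ∉ W ∧
      TensorProduct.map LinearMap.id W.mkQ (ΔC c) = (1 : H) ⊗ₜ[K] W.mkQ c := by
    by_cases hW : W = ⊤
    · exact ⟨0, fun h => absurd hW h⟩
    · obtain ⟨c, hc⟩ := G.exists_coinvariant_mkQ ΔC hcounit hcoassoc hW
      exact ⟨c, fun _ => hc⟩
  choose g hg using hex
  let W : ℕ → Submodule K C := fun k => Nat.rec ⊥ (fun _ V => V ⊔ (K ∙ g V)) k
  let e : ℕ → C := fun k => g (W k)
  have hWspan (k : ℕ) : W k = Submodule.span K (Set.range fun i : Fin k => e i) := by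
    induction k with
    | zero => simp [W]
    | succ k ih =>
      have : (Set.range fun i : Fin (k + 1) => e i) =
          (Set.range fun i : Fin k => e i) ∪ {e k} := by
        ext y
        simp [Fin.exists_fin_succ', eq_comm, or_comm]
      rw [this, Submodule.span_union, ← ih]
  have hWtop (k : ℕ) (hk : k < d) : W k ≠ ⊤ := fun h => by
    have h1 := finrank_range_le_card (R := K) (fun i : Fin k => e i)
    rw [Set.finrank, ← hWspan, h, finrank_top, hd, Fintype.card_fin] at h1
    omega
  have hli (k : ℕ) (hk : k ≤ d) : LinearIndependent K fun i : Fin k => e i := by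
    induction k with
    | zero => exact linearIndependent_empty_type
    | succ k ih =>
      refine linearIndependent_finSucc'.mpr ⟨ih (by omega), ?_⟩
      have := (hg _ (hWtop k hk)).1
      rw [hWspan] at this
      exact hWspan k ▸ this
  let b : Module.Basis (Fin d) K C := basisOfLinearIndependentOfCardEqFinrank' _ (hli d le_rfl)
    (by simp [hd])
  have hb (i : Fin d) : b i = e i := by simp [b]
  let coeff : Fin d → H ⊗[K] C →ₗ[K] H := fun j =>
    (TensorProduct.rid K H).toLinearMap ∘ₗ TensorProduct.map LinearMap.id (b.coord j)
  have hcoeff (j : Fin d) (h : H) (c : C) : coeff j (h ⊗ₜ c) = b.repr c j • h := by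
    simp [coeff]
  have hexpand (z : H ⊗[K] C) : z = ∑ j, coeff j z ⊗ₜ[K] b j := by
    induction z with
    | zero => simp
    | tmul h c =>
      conv_lhs => rw [← b.sum_repr c]
      simp only [hcoeff, TensorProduct.tmul_sum, TensorProduct.tmul_smul, TensorProduct.smul_tmul']
    | add u v hu hv =>
      simp only [map_add, TensorProduct.add_tmul, Finset.sum_add_distrib, ← hu, ← hv]
  have hupper (i j : Fin d) (hij : i ≤ j) : coeff j (ΔC (b i)) = b.repr (b i) j • 1 := by
    have hle : W i ≤ LinearMap.ker (b.coord j) := by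
      rw [hWspan, Submodule.span_le]
      rintro _ ⟨m, rfl⟩
      have := hb ⟨m, m.2.trans i.2⟩
      simp only at this
      simp only [SetLike.mem_coe, LinearMap.mem_ker, ← this, Module.Basis.coord_apply,
        Module.Basis.repr_self]
      refine Finsupp.single_eq_of_ne fun h => ?_
      have h1 := congrArg Fin.val h
      have := m.2
      simp only at h1
      omega
    have := hcoinv _ _ hle (hg _ (hWtop i i.2)).2
    rwa [show g (W i) = b i from (hb i).symm] at this
  refine ⟨b, fun i j => coeff j (ΔC (b i)), fun i => hexpand _, fun i => ?_, fun i j hij => ?_,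
    fun i j => ?_⟩
  · exact (hupper i i le_rfl).trans (by simp)
  · exact (hupper i j hij.le).trans
      (by rw [b.repr_self, Finsupp.single_eq_of_ne hij.ne', zero_smul])
  · have h := congrArg (TensorProduct.map (LinearMap.id : H →ₗ[K] H) (coeff j))
      (LinearMap.congr_fun hcoassoc (b i))
    simp only [LinearMap.comp_apply, LinearEquiv.coe_coe] at h
    have h1 : TensorProduct.map (LinearMap.id : H →ₗ[K] H) (coeff j) ∘ₗ
        (TensorProduct.assoc K H H C).toLinearMap ∘ₗ
          TensorProduct.map (Coalgebra.comul (R := K)) LinearMap.id =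
        Coalgebra.comul ∘ₗ coeff j := by
      have h2 : TensorProduct.map (LinearMap.id : H →ₗ[K] H) (coeff j) ∘ₗ
          (TensorProduct.assoc K H H C).toLinearMap =
          (TensorProduct.rid K _).toLinearMap ∘ₗ
            TensorProduct.map LinearMap.id (b.coord j) :=
        TensorProduct.ext_threefold fun x y c => by simp [hcoeff]
      rw [← LinearMap.comp_assoc, h2]
      exact TensorProduct.ext' fun x c => by simp [hcoeff]
    have h3 := LinearMap.congr_fun h1 (ΔC (b i))
    simp only [LinearMap.comp_apply, LinearEquiv.coe_coe] at h3
    rw [← h3, h]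
    conv_lhs => rw [hexpand (ΔC (b i))]
    simp only [map_sum, TensorProduct.map_tmul, LinearMap.id_apply]

end Coinvariants

section Decompositions

variable {K H : Type*} [Field K] [Ring H] [HopfAlgebra K H]

theorem sum_powerset_decompProd (top : H →ₗ[K] H →ₗ[K] H) (p : ℕ → ℕ → H) (a b d : ℕ) :
    ∑ c ∈ (Finset.Ico (b - d) b).powerset, decompProd top p a b (c.sort (· ≤ ·)) =
      p a b + ∑ j ∈ Finset.Ico (b - d) b, top (decompSum top p (j + 1) b) (p a j) := by
  induction d with
  | zero => simp [decompProd]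
  | succ d ih =>
    by_cases h : b ≤ d
    · rwa [show b - (d + 1) = b - d by omega]
    have hins : Finset.Ico (b - (d + 1)) b =
        insert (b - (d + 1)) (Finset.Ico (b - d) b) := by
      rw [← Finset.insert_Ico_add_one_left_eq_Ico (by omega)]
      congr 2
      omega
    have hnot : b - (d + 1) ∉ Finset.Ico (b - d) b := by
      simp only [Finset.mem_Ico]; omega
    rw [hins, Finset.sum_powerset_insert hnot, ih, Finset.sum_insert hnot, add_assoc,
      add_comm (top _ _)]
    congr 2
    rw [decompSum, show b - (d + 1) + 1 = b - d by omega, map_sum, LinearMap.sum_apply]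
    refine Finset.sum_congr rfl fun c hc => ?_
    have hsub := Finset.mem_powerset.mp hc
    rw [Finset.sort_insert _ (fun k hk => ?_) (fun hk => hnot (hsub hk)), decompProd,
      show b - (d + 1) + 1 = b - d by omega]
    have := Finset.mem_Ico.mp (hsub hk)
    omega

/-- Splitting off the first block of a decomposition. -/
theorem decompSum_eq (top : H →ₗ[K] H →ₗ[K] H) (p : ℕ → ℕ → H) {a b : ℕ} (hab : a ≤ b) :
    decompSum top p a b =
      p a b + ∑ j ∈ Finset.Ico a b, top (decompSum top p (j + 1) b) (p a j) := by
  have := sum_powerset_decompProd top p a b (b - a)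
  rwa [Nat.sub_sub_self hab] at this

/-- The family determined by `m a b = p a b + ∑ m (j + 1) b ⊤ p a j`. -/
noncomputable def primitiveFamily (top : H →ₗ[K] H →ₗ[K] H) (m : ℕ → ℕ → H) (a b : ℕ) : H :=
  m a b - ∑ j : Finset.Ico a b, top (m (j + 1) b) (primitiveFamily top m a j)
termination_by b
decreasing_by exact (Finset.mem_Ico.mp j.2).2

theorem primitiveFamily_eq (top : H →ₗ[K] H →ₗ[K] H) (m : ℕ → ℕ → H) (a b : ℕ) :
    primitiveFamily top m a b =
      m a b - ∑ j ∈ Finset.Ico a b, top (m (j + 1) b) (primitiveFamily top m a j) := by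
  rw [primitiveFamily, Finset.sum_coe_sort (Finset.Ico a b)
    fun j => top (m (j + 1) b) (primitiveFamily top m a j)]

theorem decompSum_primitiveFamily (top : H →ₗ[K] H →ₗ[K] H) (m : ℕ → ℕ → H) (d : ℕ) :
    ∀ a b, a ≤ b → b ≤ a + d → decompSum top (primitiveFamily top m) a b = m a b := by
  induction d with
  | zero =>
    intro a b h1 h2
    obtain rfl : a = b := by omega
    simp [decompSum_eq, primitiveFamily_eq top m a a]
  | succ d ih =>
    intro a b hab hb
    have hsum : ∀ j ∈ Finset.Ico a b,
        top (decompSum top (primitiveFamily top m) (j + 1) b) (primitiveFamily top m a j) =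
          top (m (j + 1) b) (primitiveFamily top m a j) := fun j hj => by
      obtain ⟨h1, h2⟩ := Finset.mem_Ico.mp hj
      rw [ih (j + 1) b h2 (by omega)]
    rw [decompSum_eq _ _ hab, primitiveFamily_eq, Finset.sum_congr rfl hsum, sub_add_cancel]

theorem reducedComul_primitiveFamily {top : H →ₗ[K] H →ₗ[K] H} (htop : IsNaturalGrowth top)
    {m : ℕ → ℕ → H} {n : ℕ}
    (hm : ∀ a b, 1 ≤ a → a ≤ b → b ≤ n →
      reducedComul K H (m a b) = ∑ k ∈ Finset.Ico a b, m (k + 1) b ⊗ₜ[K] m a k)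
    (a : ℕ) (ha : 1 ≤ a) (b : ℕ) :
    a ≤ b → b ≤ n → reducedComul K H (primitiveFamily top m a b) = 0 := by
  induction b using Nat.strong_induction_on with
  | _ b ih =>
    intro hab hbn
    rw [primitiveFamily_eq, map_sub, map_sum, hm a b ha hab hbn, sub_eq_zero]
    set p := primitiveFamily top m
    have hterm : ∀ j ∈ Finset.Ico a b, reducedComul K H (top (m (j + 1) b) (p a j)) =
        m (j + 1) b ⊗ₜ[K] p a j +
          ∑ k ∈ Finset.Ico (j + 1) b, m (k + 1) b ⊗ₜ[K] top (m (j + 1) k) (p a j) := by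
      intro j hj
      obtain ⟨h1, h2⟩ := Finset.mem_Ico.mp hj
      rw [htop _ _ (ih j h2 h1 (by omega)), hm _ _ (by omega) h2 hbn, map_sum]
      simp
    rw [Finset.sum_congr rfl hterm, Finset.sum_add_distrib,
      Finset.sum_comm' (t' := Finset.Ico a b) (s' := fun k => Finset.Ico a k)
        (fun j k => by simp only [Finset.mem_Ico]; omega), ← Finset.sum_add_distrib]
    refine Finset.sum_congr rfl fun k _ => ?_
    rw [← TensorProduct.tmul_sum, ← TensorProduct.tmul_add]
    congr 1
    rw [show p a k = _ from primitiveFamily_eq top m a k, sub_add_cancel]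

end Decompositions

theorem finite_dimensional_comodules_classification {K H : Type*} [Field K] [CharZero K]
    [Ring H] [HopfAlgebra K H]
    (G : HopfGrading (K := K) (H := H))
    (top : H →ₗ[K] H →ₗ[K] H) (htop : IsNaturalGrowth top)
    (C : Type*) [AddCommGroup C] [Module K C] [FiniteDimensional K C]
    (ΔC : C →ₗ[K] H ⊗[K] C)
    -- (C, Δ_C) is an H-comodule:
    (hcounit : (TensorProduct.lid K C).toLinearMap ∘ₗ
        (TensorProduct.map (Coalgebra.counit (R := K)) LinearMap.id) ∘ₗ ΔC =
      LinearMap.id)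
    (hcoassoc : (TensorProduct.assoc K H H C).toLinearMap ∘ₗ
        (TensorProduct.map (Coalgebra.comul (R := K)) LinearMap.id) ∘ₗ ΔC =
      (TensorProduct.map LinearMap.id ΔC) ∘ₗ ΔC) :
    -- if dim C = 1 then the comodule is trivial
    (Module.finrank K C = 1 → ∀ x : C, ΔC x = (1 : H) ⊗ₜ[K] x) ∧
    -- if dim C = n + 1 ≥ 2 then C ≅ C_{(p_{i,j})} for some primitive family (p_{i,j})
    (∀ n : ℕ, 1 ≤ n → Module.finrank K C = n + 1 →
      ∃ p : ℕ → ℕ → H,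
        (∀ i j : ℕ, 1 ≤ i → i ≤ j → j ≤ n → reducedComul K H (p i j) = 0) ∧
        ∃ φ : C ≃ₗ[K] (Fin (n + 1) → K),
          (TensorProduct.map LinearMap.id φ.toLinearMap) ∘ₗ ΔC =
            comoduleCoaction top p n ∘ₗ φ.toLinearMap) := by
  refine ⟨fun hd x => ?_, fun n _ hd => ?_⟩
  · obtain ⟨b, M, hΔ, hdiag, -, -⟩ := G.exists_unitriangular_basis ΔC hcounit hcoassoc hd
    rw [← b.sum_repr x]
    simp [hΔ, hdiag]
  obtain ⟨b, M, hΔ, hdiag, hupper, hcomul⟩ :=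
    G.exists_unitriangular_basis ΔC hcounit hcoassoc hd
  let m : ℕ → ℕ → H := fun i j => M (Fin.ofNat (n + 1) j) (Fin.ofNat (n + 1) (i - 1))
  have hm (i j : Fin (n + 1)) : m (j + 1) i = M i j := by simp [m]
  have hred (i j : Fin (n + 1)) (hji : j < i) :
      reducedComul K H (M i j) = ∑ k ∈ Finset.Ioo j i, M i k ⊗ₜ[K] M k j := by
    have hsplit : ∑ k, M i k ⊗ₜ[K] M k j = ∑ k ∈ Finset.Icc j i, M i k ⊗ₜ[K] M k j := by
      refine (Finset.sum_subset (Finset.subset_univ _) fun k _ hk => ?_).symm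
      rw [Finset.mem_Icc, not_and_or, not_le, not_le] at hk
      rcases hk with hk | hk <;> simp [hupper _ _ hk]
    rw [reducedComul, LinearMap.sub_apply, LinearMap.sub_apply, hcomul, hsplit,
      ← Finset.Ioc_insert_left hji.le, Finset.sum_insert (by simp),
      ← Finset.Ioo_insert_right hji, Finset.sum_insert (by simp), hdiag, hdiag]
    simp only [LinearMap.flip_apply, TensorProduct.mk_apply]
    abel
  refine ⟨primitiveFamily top m, fun i j hi hij hj =>
    reducedComul_primitiveFamily htop (n := n) (fun i j hi hij hj => ?_) i hi j hij hj,
    b.equivFun, b.ext fun i => ?_⟩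
  · obtain ⟨j, rfl⟩ : ∃ j' : Fin (n + 1), (j' : ℕ) = j := ⟨⟨j, by omega⟩, rfl⟩
    obtain ⟨i, rfl⟩ : ∃ i' : Fin (n + 1), (i' : ℕ) + 1 = i :=
      ⟨⟨i - 1, by omega⟩, Nat.sub_add_cancel hi⟩
    rw [hm, hred j i (Fin.lt_def.mpr hij)]
    refine Finset.sum_bij (fun k _ => (k : ℕ)) ?_ ?_ ?_ ?_
    · intro k hk
      simp only [Finset.mem_Ioo, Finset.mem_Ico, Fin.lt_def] at hk ⊢
      omega
    · exact fun _ _ _ _ h => Fin.ext h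
    · intro k hk
      rw [Finset.mem_Ico] at hk
      exact ⟨⟨k, by omega⟩, by simp only [Finset.mem_Ioo, Fin.lt_def]; omega, rfl⟩
    · intro k _
      rw [hm, hm]
  · have hdec (j : Fin (n + 1)) (hji : j < i) :
        decompSum top (primitiveFamily top m) (j + 1) i = M i j := by
      rw [decompSum_primitiveFamily top m i _ _ (Fin.lt_def.mp hji) (by omega), hm]
    have hsingle (j : Fin (n + 1)) : b.equivFun (b j) = Pi.single j (1 : K) := by
      ext k; simp [Pi.single_apply, eq_comm]
    have hmodel : comoduleCoaction top (primitiveFamily top m) n (Pi.single i 1) =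
        ∑ j ∈ Finset.univ.filter (· < i), M i j ⊗ₜ[K] Pi.single j (1 : K) +
          (1 : H) ⊗ₜ[K] Pi.single i (1 : K) := by
      rw [comoduleCoaction, ← Pi.basisFun_apply K, Module.Basis.constr_basis, Pi.basisFun_apply]
      congr 1
      exact Finset.sum_congr rfl fun j hj => by rw [hdec j (Finset.mem_filter.mp hj).2]
    simp only [LinearMap.comp_apply, LinearEquiv.coe_coe, hsingle, hmodel, hΔ, map_sum,
      TensorProduct.map_tmul, LinearMap.id_apply]
    rw [← Finset.sum_filter_add_sum_filter_not Finset.univ (· < i)]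
    congr 1
    rw [Finset.sum_eq_single i (fun j hj hne => ?_) (by simp), hdiag]
    rw [hupper i j (lt_of_le_of_ne (not_lt.mp (Finset.mem_filter.mp hj).2) hne.symm),
      TensorProduct.zero_tmul]
end
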